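/- arXiv:2405.04002 — 2 statements merged into one kernel-verified Lean document; each statement's English description precedes it below -/
import Mathlib

section
/- Let X ⊂ ℙ^{n+c} be a nondegenerate smooth complex projective quadratic variety of dimension n and codimension c which is not a complete intersection. If (n, c) = (3, 2), then X ⊂ ℙ^5 is projectively equivalent to the Segre 3-fold ℙ^1 × ℙ^2 ⊂ ℙ^5. -/
/-!
Common framework for formalizing "Quadratic Varieties of Small Codimension"
(K. Watanabe), following Ionescu–Russo.

We model a projective variety as a subset of the complex projective space
`PS m := ℙ ℂ (Fin m → ℂ)` (which is `ℙ^{m-1}`, with `m` homogeneous coordinates).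
-/

noncomputable section

open scoped BigOperators

/-- Complex projective space `ℙ^{m-1}`, described by `m` homogeneous coordinates. -/
abbrev PS (m : ℕ) : Type := Projectivization ℂ (Fin m → ℂ)

namespace PaperQV

/-- A polynomial vanishes at a point of projective space, i.e. on the whole
corresponding line in affine space. -/
def PVanish {m : ℕ} (p : MvPolynomial (Fin m) ℂ) (x : PS m) : Prop :=
  ∀ v ∈ x.submodule, MvPolynomial.eval v p = 0

/-- The common zero locus, in projective space, of a set of polynomials. -/
def ZeroLocus {m : ℕ} (P : Set (MvPolynomial (Fin m) ℂ)) : Set (PS m) :=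
  {x | ∀ p ∈ P, PVanish p x}

/-- Zariski-closed subsets of projective space. -/
def ZClosed {m : ℕ} (S : Set (PS m)) : Prop :=
  ∃ P : Set (MvPolynomial (Fin m) ℂ), S = ZeroLocus P

/-- Zariski closure. -/
def ZClosure {m : ℕ} (S : Set (PS m)) : Set (PS m) :=
  ⋂₀ {C | ZClosed C ∧ S ⊆ C}

/-- Irreducibility with respect to the Zariski topology. -/
def ZIrreducible {m : ℕ} (S : Set (PS m)) : Prop :=
  S.Nonempty ∧ ∀ C₁ C₂ : Set (PS m), ZClosed C₁ → ZClosed C₂ → S ⊆ C₁ ∪ C₂ →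
    S ⊆ C₁ ∨ S ⊆ C₂

/-- `X` contains a strictly increasing chain of `n + 1` irreducible Zariski-closed
subsets, i.e. `dim X ≥ n`. -/
def DimGE {m : ℕ} (X : Set (PS m)) (n : ℕ) : Prop :=
  ∃ c : Fin (n + 1) → Set (PS m),
    StrictMono c ∧ ∀ i, ZClosed (c i) ∧ ZIrreducible (c i) ∧ c i ⊆ X

/-- `X` has dimension exactly `n`. -/
def HasDim {m : ℕ} (X : Set (PS m)) (n : ℕ) : Prop :=
  DimGE X n ∧ ¬ DimGE X (n + 1)

/-- The differential of a polynomial `p` at the vector `v`, as a linear functional. -/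
def polyDiff {m : ℕ} (p : MvPolynomial (Fin m) ℂ) (v : Fin m → ℂ) :
    (Fin m → ℂ) →ₗ[ℂ] ℂ :=
  ∑ j, MvPolynomial.eval v (MvPolynomial.pderiv j p) • LinearMap.proj j

/-- The Zariski tangent space at `x ∈ X` of the affine cone over `X`:
the intersection of the kernels of the differentials at `x.rep` of all
polynomials vanishing on `X`. -/
def tangentSubmodule {m : ℕ} (X : Set (PS m)) (x : PS m) :
    Submodule ℂ (Fin m → ℂ) :=
  ⨅ (p : MvPolynomial (Fin m) ℂ) (_ : ∀ y ∈ X, PVanish p y),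
    LinearMap.ker (polyDiff p x.rep)

/-- `X ⊆ ℙ^{m-1}` is a smooth projective variety of dimension `n`:
it is Zariski closed, irreducible, of dimension `n`, and at every point the
Zariski tangent space of its affine cone has dimension `n + 1`. -/
def SmoothVariety {m : ℕ} (X : Set (PS m)) (n : ℕ) : Prop :=
  ZClosed X ∧ ZIrreducible X ∧ HasDim X n ∧
    ∀ x ∈ X, Module.finrank ℂ (tangentSubmodule X x) = n + 1

/-- `X` is nondegenerate: it is contained in no hyperplane. -/
def Nondegenerate {m : ℕ} (X : Set (PS m)) : Prop :=
  ∀ φ : (Fin m → ℂ) →ₗ[ℂ] ℂ, (∀ x ∈ X, ∀ v ∈ x.submodule, φ v = 0) → φ = 0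

/-- The hypersurfaces `Q i = 0` cut out `X` scheme-theoretically: `X` is their
set-theoretic intersection, and at every point of `X` the `Q i` realize the full
Zariski tangent space (i.e. their differentials span the conormal space, so they
generate the ideal sheaf of the smooth variety `X`). -/
def SchemeCutOutBy {m k : ℕ} (X : Set (PS m)) (Q : Fin k → MvPolynomial (Fin m) ℂ) : Prop :=
  X = {x | ∀ i, PVanish (Q i) x} ∧
    ∀ x ∈ X, ∀ p : MvPolynomial (Fin m) ℂ, (∀ y ∈ X, PVanish p y) →
      (⨅ i, LinearMap.ker (polyDiff (Q i) x.rep)) ≤ LinearMap.ker (polyDiff p x.rep)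

/-- `X` is scheme-theoretically defined by `c` (linearly) independent quadratic equations. -/
def CutOutByQuadrics {m : ℕ} (X : Set (PS m)) (c : ℕ) : Prop :=
  ∃ Q : Fin c → MvPolynomial (Fin m) ℂ,
    (∀ i, (Q i).IsHomogeneous 2) ∧ LinearIndependent ℂ Q ∧ SchemeCutOutBy X Q

/-- A quadratic variety: scheme-theoretically an intersection of quadrics. -/
def IsQuadratic {m : ℕ} (X : Set (PS m)) : Prop :=
  ∃ c : ℕ, CutOutByQuadrics X c

/-- `X ⊆ ℙ^{m-1}` of dimension `n` is a complete intersection: it is cut out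
scheme-theoretically by exactly `codim X = (m - 1) - n` hypersurfaces. -/
def IsCompleteIntersection {m : ℕ} (X : Set (PS m)) (n : ℕ) : Prop :=
  ∃ F : Fin (m - 1 - n) → MvPolynomial (Fin m) ℂ, ∃ d : Fin (m - 1 - n) → ℕ,
    (∀ i, (F i).IsHomogeneous (d i)) ∧ (∀ i, 1 ≤ d i) ∧ SchemeCutOutBy X F

/-- Lines in projective space: projectivizations of 2-dimensional subspaces. -/
def IsLine {m : ℕ} (L : Set (PS m)) : Prop :=
  ∃ W : Submodule ℂ (Fin m → ℂ), Module.finrank ℂ W = 2 ∧ L = {x | x.submodule ≤ W}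

/-- `X` is covered by lines. -/
def CoveredByLines {m : ℕ} (X : Set (PS m)) : Prop :=
  ∀ x ∈ X, ∃ L : Set (PS m), IsLine L ∧ x ∈ L ∧ L ⊆ X

/-- `X` and `Y` are projectively equivalent (via a linear isomorphism of the
ambient homogeneous coordinate spaces). -/
def ProjEquiv {m₁ m₂ : ℕ} (X : Set (PS m₁)) (Y : Set (PS m₂)) : Prop :=
  ∃ (f : (Fin m₁ → ℂ) →ₗ[ℂ] (Fin m₂ → ℂ)) (hf : Function.Injective f),
    Function.Surjective f ∧ Projectivization.map f hf '' X = Y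

/-- `X ⊆ ℙ^{m₁-1}` is projectively equivalent to a hyperplane section of
`S ⊆ ℙ^{m₂-1}`: a linear embedding of the ambient space of `X` onto a hyperplane
carries `X` onto the corresponding hyperplane section of `S`. -/
def ProjEquivToHyperplaneSection {m₁ m₂ : ℕ} (X : Set (PS m₁)) (S : Set (PS m₂)) : Prop :=
  ∃ (f : (Fin m₁ → ℂ) →ₗ[ℂ] (Fin m₂ → ℂ)) (hf : Function.Injective f),
    Module.finrank ℂ (LinearMap.range f) + 1 = m₂ ∧
    Projectivization.map f hf '' X = S ∩ {y | y.submodule ≤ LinearMap.range f}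

/-! ### Explicit varieties: the Segre 3-fold, the Grassmannian `G(2,ℂ⁵)`,
the 10-dimensional spinor variety, cones, and Gushel–Mukai 6-folds. -/

/-- Index bookkeeping for the Segre embedding `ℙ¹ × ℙ² → ℙ⁵`. -/
def segreIdx : Fin 6 → Fin 2 × Fin 3 :=
  ![(0, 0), (0, 1), (0, 2), (1, 0), (1, 1), (1, 2)]

/-- The Segre coordinates of a pair of vectors. -/
def segreVec (a : Fin 2 → ℂ) (b : Fin 3 → ℂ) : Fin 6 → ℂ :=
  fun k => a (segreIdx k).1 * b (segreIdx k).2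

/-- The Segre 3-fold `ℙ¹ × ℙ² ⊆ ℙ⁵`. -/
def Segre12 : Set (PS 6) :=
  {x | ∃ (a : Fin 2 → ℂ) (b : Fin 3 → ℂ) (hv : segreVec a b ≠ 0),
    x = Projectivization.mk ℂ (segreVec a b) hv}

/-- The pairs `i < j` in `Fin 5`, indexing Plücker coordinates. -/
def pluckerPair : Fin 10 → Fin 5 × Fin 5 :=
  ![(0, 1), (0, 2), (0, 3), (0, 4), (1, 2), (1, 3), (1, 4), (2, 3), (2, 4), (3, 4)]

/-- The Plücker coordinates of the 2-plane spanned by `a`, `b` in `ℂ⁵`. -/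
def pluckerVec (a b : Fin 5 → ℂ) : Fin 10 → ℂ :=
  fun k => a (pluckerPair k).1 * b (pluckerPair k).2
    - a (pluckerPair k).2 * b (pluckerPair k).1

/-- The Grassmannian `G(2, ℂ⁵) ⊆ ℙ⁹` in its Plücker embedding. -/
def Grass25 : Set (PS 10) :=
  {x | ∃ (a b : Fin 5 → ℂ) (hv : pluckerVec a b ≠ 0),
    x = Projectivization.mk ℂ (pluckerVec a b) hv}

/-- `pfc i` lists the four elements of `Fin 5 \ {i}`, in increasing order. -/
def pfc : Fin 5 → Fin 4 → Fin 5 :=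
  ![![1, 2, 3, 4], ![0, 2, 3, 4], ![0, 1, 3, 4], ![0, 1, 2, 4], ![0, 1, 2, 3]]

/-- The sub-Pfaffian of a (skew-symmetric) `5 × 5` matrix obtained by deleting
the `i`-th row and column. -/
def subPfaffian (A : Fin 5 → Fin 5 → ℂ) (i : Fin 5) : ℂ :=
  A (pfc i 0) (pfc i 1) * A (pfc i 2) (pfc i 3)
    - A (pfc i 0) (pfc i 2) * A (pfc i 1) (pfc i 3)
    + A (pfc i 0) (pfc i 3) * A (pfc i 1) (pfc i 2)

/-- The spinor coordinates `(1, (a_{ij})_{i<j}, (Pf_i(A))_i)` of a skew-symmetric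
`5 × 5` matrix: the affine parametrization of the spinor embedding. -/
def spinorTail (A : Fin 5 → Fin 5 → ℂ) : Fin 15 → ℂ :=
  (Fin.append (fun t : Fin 10 => A (pluckerPair t).1 (pluckerPair t).2)
    (subPfaffian A) : Fin (10 + 5) → ℂ)

def spinorVec (A : Fin 5 → Fin 5 → ℂ) : Fin 16 → ℂ :=
  fun k =>
    (Fin.cons (1 : ℂ) (spinorTail A) : Fin (15 + 1) → ℂ)
      (Fin.cast (show (16 : ℕ) = 15 + 1 by norm_num) k)

/-- The 10-dimensional spinor variety `S^{10} ⊆ ℙ^{15}`: the Zariski closure of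
the image of the space of skew-symmetric `5 × 5` matrices under the
sub-Pfaffian (spinor) parametrization. -/
def Spinor10 : Set (PS 16) :=
  ZClosure {x | ∃ A : Fin 5 → Fin 5 → ℂ, (∀ i j, A j i = - A i j) ∧
    ∃ hv : spinorVec A ≠ 0, x = Projectivization.mk ℂ (spinorVec A) hv}

/-- The cone with vertex `o` over a subset `Y` of projective space. -/
def ConeOver {m : ℕ} (o : PS m) (Y : Set (PS m)) : Set (PS m) :=
  {z | z = o ∨ ∃ y ∈ Y, z.submodule ≤ o.submodule ⊔ y.submodule}

/-- Gushel–Mukai 6-folds `Σ^6_{10} ⊆ ℙ^{10}`: smooth 6-dimensional sections of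
the cone over the Plücker-embedded `G(2,ℂ⁵) ⊆ ℙ⁹ ⊆ ℙ^{10}` by a smooth quadric
hypersurface. -/
def IsGushelMukai6 (W : Set (PS 11)) : Prop :=
  ∃ (f : (Fin 10 → ℂ) →ₗ[ℂ] (Fin 11 → ℂ)) (hf : Function.Injective f)
    (o : PS 11) (q : MvPolynomial (Fin 11) ℂ),
    ¬ o.submodule ≤ LinearMap.range f ∧
    q.IsHomogeneous 2 ∧
    (∀ v : Fin 11 → ℂ, MvPolynomial.eval v q = 0 →
      (∀ j, MvPolynomial.eval v (MvPolynomial.pderiv j q) = 0) → v = 0) ∧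
    W = ConeOver o (Projectivization.map f hf '' Grass25) ∩ {x | PVanish q x} ∧
    SmoothVariety W 6

/-! ### Lines through a point, the Hilbert scheme of lines `L_x`, general points. -/

/-- The line through `x` with direction vector `v` (the projectivization of the
span of `x` and `v`). -/
def LineThrough {m : ℕ} (x : PS m) (v : Fin m → ℂ) : Set (PS m) :=
  {y | y.submodule ≤ x.submodule ⊔ Submodule.span ℂ {v}}

/-- `W ⊆ ℙ^{n-1} = ℙ(T_x X)` is a model, via the tangent map, of the Hilbert
scheme `L_x` of lines on `X` through `x`:  a linear identification `j` of `ℂⁿ`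
with a complement of the line `x̂` inside the (affine cone) tangent space of `X`
at `x` carries `W` onto the set of tangent directions of lines on `X` through `x`. -/
def IsVMRTModel {m n : ℕ} (X : Set (PS m)) (x : PS m) (W : Set (PS n)) : Prop :=
  ∃ j : (Fin n → ℂ) →ₗ[ℂ] (Fin m → ℂ), Function.Injective j ∧
    LinearMap.range j ⊓ x.submodule = ⊥ ∧
    LinearMap.range j ⊔ x.submodule = tangentSubmodule X x ∧
    W = {u : PS n | LineThrough x (j u.rep) ⊆ X}

/-- `P` holds at all points of `X` off some proper Zariski-closed subset,
i.e. at a general point of `X`. -/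
def GenericallyOn {m : ℕ} (X : Set (PS m)) (P : PS m → Prop) : Prop :=
  ∃ C : Set (PS m), ZClosed C ∧ ¬ X ⊆ C ∧ ∀ x ∈ X \ C, P x

/-- The locus swept out by the lines on `X` through `x`. -/
def LocusOfLines {m : ℕ} (X : Set (PS m)) (x : PS m) : Set (PS m) :=
  ⋃₀ {L | IsLine L ∧ x ∈ L ∧ L ⊆ X}

/-! ### Products, morphisms, double covers, conics. -/

/-- Zariski-closed subsets of a product of projective spaces (cut out by
multihomogeneous polynomials in the two groups of variables). -/
def ZClosedProd {m₁ m₂ : ℕ} (S : Set (PS m₁ × PS m₂)) : Prop :=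
  ∃ P : Set (MvPolynomial (Fin m₁ ⊕ Fin m₂) ℂ),
    S = {z | ∀ p ∈ P, ∀ v ∈ z.1.submodule, ∀ w ∈ z.2.submodule,
      MvPolynomial.eval (Sum.elim v w) p = 0}

/-- `f` restricts to a morphism of projective varieties `X → Y`
(its graph over `X` is Zariski closed). -/
def IsMorphismOn {m₁ m₂ : ℕ} (X : Set (PS m₁)) (Y : Set (PS m₂))
    (f : PS m₁ → PS m₂) : Prop :=
  Set.MapsTo f X Y ∧ ZClosedProd {z : PS m₁ × PS m₂ | z.1 ∈ X ∧ z.2 = f z.1}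

/-- A double cover `X → Y`: a finite surjective morphism of degree `2`. -/
def IsDoubleCover {m₁ m₂ : ℕ} (X : Set (PS m₁)) (Y : Set (PS m₂))
    (f : PS m₁ → PS m₂) : Prop :=
  IsMorphismOn X Y f ∧ Set.SurjOn f X Y ∧
    (∀ y ∈ Y, {x | x ∈ X ∧ f x = y}.Finite) ∧
    GenericallyOn Y (fun y => {x | x ∈ X ∧ f x = y}.ncard = 2)

/-- Irreducible conics: irreducible plane sections of quadrics that are neither
lines nor full planes. -/
def IsIrreducibleConic {m : ℕ} (C : Set (PS m)) : Prop :=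
  ∃ (W : Submodule ℂ (Fin m → ℂ)) (q : MvPolynomial (Fin m) ℂ),
    Module.finrank ℂ W = 3 ∧ q.IsHomogeneous 2 ∧
    C = {x | x.submodule ≤ W ∧ PVanish q x} ∧
    ZIrreducible C ∧ ¬ IsLine C ∧ C ≠ {x | x.submodule ≤ W}

/-- "P holds for two general points of X." -/
def GenericallyOnPairs {m : ℕ} (X : Set (PS m)) (P : PS m → PS m → Prop) : Prop :=
  ∃ B : Set (PS m × PS m), ZClosedProd B ∧ ¬ X ×ˢ X ⊆ B ∧
    ∀ x ∈ X, ∀ y ∈ X, (x, y) ∉ B → P x y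

/-- `X` is conic-connected: through two general points of `X` there passes an
irreducible conic contained in `X`. -/
def ConicConnected {m : ℕ} (X : Set (PS m)) : Prop :=
  GenericallyOnPairs X fun x y =>
    ∃ C : Set (PS m), IsIrreducibleConic C ∧ C ⊆ X ∧ x ∈ C ∧ y ∈ C

/-- An interpretation of the transcendental / cohomological invariants of
embedded projective varieties used in the paper: being Fano, the Fano index,
`Pic ≅ ℤ`, degrees of normal bundles of lines, the degree, and conditions on
`H²`, `H⁴`, Chern classes and the second Chern character. -/
structure GeomInterp where
  /-- `X` is a Fano variety. -/
  IsFanoVariety : ∀ {m : ℕ}, Set (PS m) → Prop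
  /-- The Fano index of `X`: the maximal `r` such that `r` divides `-K_X` in `Pic X`. -/
  fanoIndex : ∀ {m : ℕ}, Set (PS m) → ℕ
  /-- `Pic X ≅ ℤ`. -/
  PicIsZ : ∀ {m : ℕ}, Set (PS m) → Prop
  /-- `deg N_{ℓ/X}`, the degree of the normal bundle of a line `ℓ ⊆ X`. -/
  normalBundleDeg : ∀ {m : ℕ}, Set (PS m) → Set (PS m) → ℤ
  /-- The degree of `X`, i.e. the self-intersection number `H^{dim X}`. -/
  degreeOf : ∀ {m : ℕ}, Set (PS m) → ℕ
  /-- `H²(X, ℤ) ≅ ℤ[H]`, generated by the hyperplane class. -/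
  H2GenByHyperplane : ∀ {m : ℕ}, Set (PS m) → Prop
  /-- `H⁴(X, ℤ) ≅ ℤ[H²]`. -/
  H4GenByHyperplaneSq : ∀ {m : ℕ}, Set (PS m) → Prop
  /-- `c₁(X) = a·H` in `H²(X, ℤ)`. -/
  c1Eq : ∀ {m : ℕ}, Set (PS m) → ℤ → Prop
  /-- `c₂(X) = a·H²` in `H⁴(X, ℤ)`. -/
  c2Eq : ∀ {m : ℕ}, Set (PS m) → ℤ → Prop
  /-- `ch₂(X) = (c₁(X)² - 2c₂(X))/2 = a·H²` in `H⁴(X, ℤ)`. -/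
  ch2Eq : ∀ {m : ℕ}, Set (PS m) → ℤ → Prop

end PaperQV

open PaperQV

namespace PaperQV

section VanishingIdeal

variable {m : ℕ}

/-- The restriction of a polynomial to an affine line, as a polynomial in the parameter. -/
lemma exists_restrict_line (f : MvPolynomial (Fin m) ℂ) (y v : Fin m → ℂ) :
    ∃ p : Polynomial ℂ, ∀ t : ℂ, p.eval t = MvPolynomial.eval (y + t • v) f := by
  refine ⟨MvPolynomial.aeval
    (fun i => Polynomial.C (y i) + Polynomial.X * Polynomial.C (v i)) f, fun t => ?_⟩
  rw [← Polynomial.coe_evalRingHom, MvPolynomial.map_aeval, MvPolynomial.eval]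
  congr 2
  · ext a; simp
  · ext i; simpa using mul_comm _ _

lemma eval_line_eq_zero_of_infinite {f : MvPolynomial (Fin m) ℂ} {y v : Fin m → ℂ}
    (h : {t : ℂ | MvPolynomial.eval (y + t • v) f = 0}.Infinite) (t : ℂ) :
    MvPolynomial.eval (y + t • v) f = 0 := by
  obtain ⟨p, hp⟩ := exists_restrict_line f y v
  have : p = 0 := Polynomial.eq_zero_of_infinite_isRoot p (by simpa [Polynomial.IsRoot, hp] using h)
  rw [← hp, this, Polynomial.eval_zero]

lemma pVanish_iff (p : MvPolynomial (Fin m) ℂ) (x : PS m) :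
    PVanish p x ↔ ∀ t : ℂ, MvPolynomial.eval (t • x.rep) p = 0 := by
  simp [PVanish, Projectivization.submodule_eq, Submodule.mem_span_singleton]

lemma pVanish_mul {f g : MvPolynomial (Fin m) ℂ} {x : PS m} (h : PVanish (f * g) x) :
    PVanish f x ∨ PVanish g x := by
  simp only [pVanish_iff] at h ⊢
  have key : ∀ f : MvPolynomial (Fin m) ℂ,
      {t : ℂ | MvPolynomial.eval (t • x.rep) f = 0}.Infinite →
        ∀ t : ℂ, MvPolynomial.eval (t • x.rep) f = 0 := fun f hf => by
    simpa using eval_line_eq_zero_of_infinite (f := f) (y := 0) (v := x.rep) (by simpa using hf)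
  have hu : ({t : ℂ | MvPolynomial.eval (t • x.rep) f = 0} ∪
      {t : ℂ | MvPolynomial.eval (t • x.rep) g = 0}).Infinite := by
    rw [Set.eq_univ_of_forall (s := _ ∪ _)]
    · exact Set.infinite_univ
    · intro t
      simpa using h t
  exact (Set.infinite_union.1 hu).imp (key f) (key g)

/-- The ideal of all polynomials vanishing on the affine cone over `S`. -/
def vanishingIdeal (S : Set (PS m)) : Ideal (MvPolynomial (Fin m) ℂ) where
  carrier := {p | ∀ x ∈ S, PVanish p x}
  add_mem' ha hb x hx v hv := by simp [ha x hx v hv, hb x hx v hv]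
  zero_mem' x _ v _ := by simp
  smul_mem' c p hp x hx v hv := by simp [hp x hx v hv]

lemma mem_vanishingIdeal {S : Set (PS m)} {p : MvPolynomial (Fin m) ℂ} :
    p ∈ vanishingIdeal S ↔ ∀ x ∈ S, PVanish p x := Iff.rfl

lemma vanishingIdeal_anti {S T : Set (PS m)} (h : S ⊆ T) :
    vanishingIdeal T ≤ vanishingIdeal S := fun _ hp x hx => hp x (h hx)

lemma vanishingIdeal_strictAnti {S T : Set (PS m)} (hS : ZClosed S) (h : S < T) :
    vanishingIdeal T < vanishingIdeal S := by
  refine lt_of_le_not_ge (vanishingIdeal_anti h.le) fun hle => h.not_ge ?_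
  obtain ⟨P, rfl⟩ := hS
  exact fun x hx p hp => hle (fun y hy => hy p hp) x hx

lemma vanishingIdeal_isPrime {S : Set (PS m)} (hS : ZIrreducible S) :
    (vanishingIdeal S).IsPrime := by
  refine ⟨?_, ?_⟩
  · rw [Ideal.ne_top_iff_one]
    obtain ⟨x, hx⟩ := hS.1
    intro h
    simpa using h x hx 0 (zero_mem _)
  · intro f g hfg
    have := hS.2 (ZeroLocus {f}) (ZeroLocus {g}) ⟨_, rfl⟩ ⟨_, rfl⟩ fun x hx => by
      simpa [ZeroLocus] using pVanish_mul (hfg x hx)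
    simpa [ZeroLocus, Set.subset_def, mem_vanishingIdeal] using this

/-- The ideal of the cone over `X` with direction `v`. -/
def coneIdeal (X : Set (PS m)) (v : Fin m → ℂ) : Ideal (MvPolynomial (Fin m) ℂ) where
  carrier := {p | ∀ x ∈ X, ∀ y ∈ x.submodule, ∀ t : ℂ, MvPolynomial.eval (y + t • v) p = 0}
  add_mem' ha hb x hx y hy t := by simp [ha x hx y hy t, hb x hx y hy t]
  zero_mem' x _ v _ := by simp
  smul_mem' c p hp x hx y hy t := by simp [hp x hx y hy t]

lemma coneIdeal_le (X : Set (PS m)) (v : Fin m → ℂ) : coneIdeal X v ≤ vanishingIdeal X :=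
  fun p hp x hx y hy => by simpa using hp x hx y hy 0

lemma coneIdeal_isPrime {X : Set (PS m)} (hX : ZIrreducible X) (v : Fin m → ℂ) :
    (coneIdeal X v).IsPrime := by
  have hP := vanishingIdeal_isPrime hX
  refine ⟨fun h => hP.ne_top (top_le_iff.1 (h ▸ coneIdeal_le X v)), ?_⟩
  intro f g hfg
  let τ : ℂ → MvPolynomial (Fin m) ℂ →ₐ[ℂ] MvPolynomial (Fin m) ℂ := fun t =>
    MvPolynomial.aeval fun i => MvPolynomial.X i + MvPolynomial.C (t * v i)
  have hτ : ∀ t f y, MvPolynomial.eval y (τ t f) = MvPolynomial.eval (y + t • v) f := by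
    intro t f y
    rw [MvPolynomial.map_aeval, MvPolynomial.eval]
    congr 2
    · ext a; simp
    · ext i; simp
  have key : ∀ f : MvPolynomial (Fin m) ℂ,
      {t : ℂ | τ t f ∈ vanishingIdeal X}.Infinite → f ∈ coneIdeal X v := fun f hf x hx y hy =>
    eval_line_eq_zero_of_infinite (hf.mono fun t ht => by
      simpa [hτ] using ht x hx y hy)
  have hu : ({t : ℂ | τ t f ∈ vanishingIdeal X} ∪ {t | τ t g ∈ vanishingIdeal X}).Infinite := by
    rw [Set.eq_univ_of_forall (s := _ ∪ _)]
    · exact Set.infinite_univ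
    · intro t
      refine hP.mem_or_mem (x := τ t f) (y := τ t g) ?_
      intro x hx y hy
      rw [← map_mul, hτ]
      exact hfg x hx y hy t
  exact (Set.infinite_union.1 hu).imp (key f) (key g)

/-- A chain of `n + 1` irreducible closed subsets of `X ⊆ ℙ^{m-1}` bounds the length of chains of
primes strictly below the ideal of `X`. -/
lemma length_add_le_of_dimGE {X : Set (PS m)} {n : ℕ} (hX : DimGE X n)
    (s : LTSeries (PrimeSpectrum (MvPolynomial (Fin m) ℂ)))
    (hs : s.last.asIdeal < vanishingIdeal X) : s.length + n + 2 ≤ m := by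
  obtain ⟨c, hc, hcX⟩ := hX
  let r : LTSeries (PrimeSpectrum (MvPolynomial (Fin m) ℂ)) :=
    LTSeries.mk n (fun i => ⟨vanishingIdeal (c i.rev), vanishingIdeal_isPrime (hcX _).2.1⟩)
      fun i j hij => vanishingIdeal_strictAnti (hcX _).1 (hc (Fin.rev_lt_rev.2 hij))
  let M : PrimeSpectrum (MvPolynomial (Fin m) ℂ) :=
    ⟨RingHom.ker (MvPolynomial.eval (0 : Fin m → ℂ)), RingHom.ker_isPrime _⟩
  have hM : r.last < M := by
    change vanishingIdeal (c (Fin.last n).rev) < RingHom.ker (MvPolynomial.eval (0 : Fin m → ℂ))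
    obtain ⟨x, hx⟩ := (hcX (Fin.last n).rev).2.1.1
    refine lt_of_le_of_ne (fun p hp => hp x hx 0 (zero_mem _)) fun h => x.rep_nonzero ?_
    ext i
    have hi : MvPolynomial.X i ∈ vanishingIdeal (c (Fin.last n).rev) := by
      rw [h]; simp [RingHom.mem_ker]
    simpa using (pVanish_iff _ _).1 (hi x hx) 1
  have hsr : s.last < (r.snoc M hM).head := by
    rw [RelSeries.head_snoc]
    change s.last.asIdeal < vanishingIdeal (c (Fin.rev 0))
    exact lt_of_lt_of_le hs (vanishingIdeal_anti (hcX _).2.2)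
  have hle := Order.LTSeries.length_le_krullDim (s.append (r.snoc M hM) hsr)
  have hdim : Order.krullDim (PrimeSpectrum (MvPolynomial (Fin m) ℂ)) = m := by
    have := MvPolynomial.ringKrullDim_of_isNoetherianRing (R := ℂ) (ι := Fin m)
    rw [ringKrullDim_eq_zero_of_field] at this
    simpa [ringKrullDim] using this
  rw [hdim] at hle
  have : s.length + (n + 1) + 1 ≤ m := by exact_mod_cast hle
  omega

/-- A nonzero prime ideal strictly contained in the ideal of a variety of codimension two is
generated by any of its prime elements. -/
lemma dvd_of_mem_of_lt_vanishingIdeal {n : ℕ} {X : Set (PS (n + 3))} (hd : DimGE X n)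
    {J : Ideal (MvPolynomial (Fin (n + 3)) ℂ)} (hJ : J.IsPrime)
    (hlt : J < vanishingIdeal X) {q f : MvPolynomial (Fin (n + 3)) ℂ} (hq : Irreducible q)
    (hqJ : q ∈ J) (hf : f ∈ J) : q ∣ f := by
  by_contra hqf
  have hqp : (Ideal.span {q}).IsPrime :=
    (Ideal.span_singleton_prime hq.ne_zero).2 hq.prime
  let s : LTSeries (PrimeSpectrum (MvPolynomial (Fin (n + 3)) ℂ)) :=
    ((RelSeries.singleton _ ⟨⊥, Ideal.isPrime_bot⟩).snoc ⟨_, hqp⟩ (by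
      change (⊥ : Ideal _) < Ideal.span {q}
      simpa [bot_lt_iff_ne_bot] using hq.ne_zero)).snoc ⟨J, hJ⟩ (by
      rw [RelSeries.last_snoc]
      change Ideal.span {q} < J
      refine lt_of_le_of_ne ((Ideal.span_singleton_le_iff_mem _).2 hqJ) fun h => hqf ?_
      rwa [← Ideal.mem_span_singleton, h])
  have := length_add_le_of_dimGE hd s (by simpa [s] using hlt)
  simp [s] at this
  omega

end VanishingIdeal

section LinearAlgebra

lemma apply_eq_sum_single {n : ℕ} (l : (Fin n → ℂ) →ₗ[ℂ] ℂ) (w : Fin n → ℂ) :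
    l w = ∑ i, l (Pi.single i 1) * w i := by
  rw [LinearMap.pi_apply_eq_sum_univ]
  refine Finset.sum_congr rfl fun i _ => ?_
  rw [smul_eq_mul, mul_comm]
  congr 2
  ext j
  simp [Pi.single_apply, eq_comm]

variable {V : Type*} [AddCommGroup V] [Module ℂ V]

lemma self_eq_mul_of_vanish_on_ker (B : LinearMap.BilinForm ℂ V) {l : V →ₗ[ℂ] ℂ} {e : V}
    (he : l e = 1) (h : ∀ w, l w = 0 → B w w = 0) :
    ∃ c : V →ₗ[ℂ] ℂ, ∀ w, B w w = l w * c w := by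
  refine ⟨B.flip e + B e - B e e • l, fun w => ?_⟩
  have := h (w - l w • e) (by simp [he])
  simp at this ⊢
  linear_combination this

lemma self_eq_add_of_vanish_on_ker (B : LinearMap.BilinForm ℂ V) {l l' : V →ₗ[ℂ] ℂ} {e e' : V}
    (he : l e = 1) (he' : l' e' = 1) (hle' : l e' = 0) (hl'e : l' e = 0)
    (h : ∀ w, l w = 0 → l' w = 0 → B w w = 0) :
    ∃ a b : V →ₗ[ℂ] ℂ, ∀ w, B w w = l w * a w + l' w * b w := by
  refine ⟨B.flip e + B e - B e e • l - B e e' • l', B.flip e' + B e' - B e' e' • l' - B e' e • l,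
    fun w => ?_⟩
  have := h (w - l w • e - l' w • e') (by simp [he, hle']) (by simp [he', hl'e])
  simp at this ⊢
  linear_combination this

lemma self_eq_zero_of_mul_eq_zero (B : LinearMap.BilinForm ℂ V) {l : V →ₗ[ℂ] ℂ} {e w : V}
    (he : l e = 1) (h : ∀ t : ℂ, l (w + t • e) * B (w + t • e) (w + t • e) = 0) :
    B w w = 0 := by
  by_cases hw : l w = 0
  · have h1 := h 1
    have h2 := h (-1)
    have h3 := h 2
    have h4 := h (-2)
    simp [hw, he] at h1 h2 h3 h4
    linear_combination (2 / 3) * h1 - (2 / 3) * h2 - (1 / 6) * h3 - (1 / 6) * h4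
  · simpa [hw] using h 0

/-- The Koszul complex of three independent linear forms is exact in the relevant degree: a linear
syzygy between three quadratic forms exhibits them as the minors of a `2 × 3` matrix. -/
lemma exists_minors_of_syzygy (B : Fin 3 → LinearMap.BilinForm ℂ V) (l : Fin 3 → V →ₗ[ℂ] ℂ)
    {e : Fin 3 → V} (he : ∀ i j, l i (e j) = if i = j then 1 else 0)
    (h : ∀ w, l 0 w * B 0 w w + l 1 w * B 1 w w + l 2 w * B 2 w w = 0) :
    ∃ m : Fin 3 → V →ₗ[ℂ] ℂ, ∀ w, B 0 w w = l 1 w * m 2 w - l 2 w * m 1 w ∧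
      B 1 w w = l 2 w * m 0 w - l 0 w * m 2 w ∧ B 2 w w = l 0 w * m 1 w - l 1 w * m 0 w := by
  obtain ⟨a, b, hab⟩ := self_eq_add_of_vanish_on_ker (B 0) (l := l 1) (l' := l 2) (e := e 1)
    (e' := e 2) (by simp [he]) (by simp [he]) (by simp [he]) (by simp [he]) fun w h1 h2 =>
      self_eq_zero_of_mul_eq_zero (B 0) (l := l 0) (e := e 0) (by simp [he]) fun t => by
        simpa [he, h1, h2] using h (w + t • e 0)
  have hker : ∀ w, l 1 w * (B 1 w w + l 0 w * a w) + l 2 w * (B 2 w w + l 0 w * b w) = 0 := by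
    intro w
    linear_combination h w - l 0 w * hab w
  let G : LinearMap.BilinForm ℂ V := B 1 + (LinearMap.mul ℂ ℂ).compl₁₂ (l 0) a
  have hG : ∀ w, G w w = B 1 w w + l 0 w * a w := fun w => by simp [G]
  let H : LinearMap.BilinForm ℂ V := B 2 + (LinearMap.mul ℂ ℂ).compl₁₂ (l 0) b
  have hH : ∀ w, H w w = B 2 w w + l 0 w * b w := fun w => by simp [H]
  simp only [← hG, ← hH] at hker
  obtain ⟨c, hc⟩ := self_eq_mul_of_vanish_on_ker G (l := l 2) (e := e 2) (by simp [he])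
    fun w h2 => self_eq_zero_of_mul_eq_zero G (l := l 1) (e := e 1) (by simp [he]) fun t => by
      simpa [he, h2] using hker (w + t • e 1)
  let K : LinearMap.BilinForm ℂ V := H + (LinearMap.mul ℂ ℂ).compl₁₂ (l 1) c
  have hK : ∀ w, K w w = H w w + l 1 w * c w := fun w => by simp [K]
  have hK0 : ∀ w, K w w = 0 := fun w =>
    self_eq_zero_of_mul_eq_zero K (l := l 2) (e := e 2) (by simp [he]) fun t => by
      rw [hK]
      linear_combination hker (w + t • e 2) - l 1 (w + t • e 2) * hc (w + t • e 2)
  refine ⟨![c, -b, a], fun w => ⟨?_, ?_, ?_⟩⟩ <;> simp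
  · linear_combination hab w
  · linear_combination hc w - hG w
  · linear_combination hK0 w - hK w - hH w

/-- A linearly independent family of functionals has a dual family of vectors. -/
lemma exists_dual_vectors [FiniteDimensional ℂ V] {n : ℕ} {l : Fin n → V →ₗ[ℂ] ℂ}
    (hl : LinearIndependent ℂ l) :
    ∃ e : Fin n → V, ∀ i j, l i (e j) = if i = j then 1 else 0 := by
  have hs : Function.Surjective (LinearMap.pi l) := by
    rw [← LinearMap.range_eq_top]
    by_contra hne
    obtain ⟨φ, hφ, hle⟩ := Submodule.exists_le_ker_of_lt_top _ (lt_top_iff_ne_top.2 hne)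
    have hφl : ∑ i, φ (Pi.single i 1) • l i = 0 := by
      ext w
      have : φ (LinearMap.pi l w) = 0 := hle ⟨w, rfl⟩
      rw [apply_eq_sum_single] at this
      simpa using this
    refine hφ (LinearMap.pi_ext' fun i => LinearMap.ext_ring ?_)
    simpa using Fintype.linearIndependent_iff.1 hl _ hφl i
  choose e he using fun j : Fin n => hs (Pi.single j 1)
  refine ⟨e, fun i j => ?_⟩
  simpa [Pi.single_apply] using congrFun (he j) i

end LinearAlgebra

section Polynomials

open MvPolynomial

variable {m : ℕ}

/-- The linear polynomial attached to a functional. -/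
def linPoly (l : (Fin m → ℂ) →ₗ[ℂ] ℂ) : MvPolynomial (Fin m) ℂ :=
  ∑ i, C (l (Pi.single i 1)) * X i

lemma eval_linPoly (l : (Fin m → ℂ) →ₗ[ℂ] ℂ) (w : Fin m → ℂ) : eval w (linPoly l) = l w := by
  rw [apply_eq_sum_single]
  simp [linPoly]

lemma isHomogeneous_linPoly (l : (Fin m → ℂ) →ₗ[ℂ] ℂ) : (linPoly l).IsHomogeneous 1 :=
  IsHomogeneous.sum _ _ _ fun _ _ => isHomogeneous_C_mul_X _ _

lemma pderiv_linPoly (l : (Fin m → ℂ) →ₗ[ℂ] ℂ) (i : Fin m) :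
    pderiv i (linPoly l) = C (l (Pi.single i 1)) := by
  simp [linPoly, pderiv_X, Pi.single_apply, Derivation.leibniz]

lemma exists_linear_of_isHomogeneous_one {p : MvPolynomial (Fin m) ℂ} (hp : p.IsHomogeneous 1) :
    ∃ l : (Fin m → ℂ) →ₗ[ℂ] ℂ, p = linPoly l := by
  have hc : ∀ i, pderiv i p = C (coeff 0 (pderiv i p)) := fun i =>
    totalDegree_eq_zero_iff_eq_C.1 ((totalDegree_zero_iff_isHomogeneous _).2 hp.pderiv)
  refine ⟨∑ i, coeff 0 (pderiv i p) • LinearMap.proj i, ?_⟩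
  have := hp.sum_X_mul_pderiv
  rw [one_smul] at this
  conv_lhs => rw [← this]
  refine Finset.sum_congr rfl fun i _ => ?_
  conv_lhs => rw [hc i]
  simp [LinearMap.sum_apply, Pi.single_apply, mul_comm]

lemma exists_affine_of_totalDegree_le_one {p : MvPolynomial (Fin m) ℂ} (hp : p.totalDegree ≤ 1) :
    ∃ (c : ℂ) (l : (Fin m → ℂ) →ₗ[ℂ] ℂ), p = C c + linPoly l := by
  obtain ⟨l, hl⟩ := exists_linear_of_isHomogeneous_one (homogeneousComponent_isHomogeneous 1 p)
  refine ⟨coeff 0 p, l, ?_⟩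
  rw [← hl, ← homogeneousComponent_zero]
  conv_lhs => rw [← sum_homogeneousComponent p]
  obtain h | h : p.totalDegree = 0 ∨ p.totalDegree = 1 := by omega
  · simp [h, homogeneousComponent_eq_zero 1 p (by omega)]
  · simp [h, Finset.sum_range_succ]

lemma polyDiff_apply (p : MvPolynomial (Fin m) ℂ) (v w : Fin m → ℂ) :
    polyDiff p v w = ∑ j, eval v (pderiv j p) * w j := by
  simp [polyDiff]

/-- A quadratic polynomial is given by a symmetric bilinear form. -/
lemma exists_bilin_of_isHomogeneous_two {q : MvPolynomial (Fin m) ℂ} (hq : q.IsHomogeneous 2) :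
    ∃ B : LinearMap.BilinForm ℂ (Fin m → ℂ), (∀ v w, B v w = B w v) ∧
      (∀ w, eval w q = B w w) ∧ ∀ v w, polyDiff q v w = 2 * B v w := by
  choose l hl using fun i => exists_linear_of_isHomogeneous_one (hq.pderiv (i := i))
  have hsymm : ∀ i j, l i (Pi.single j 1) = l j (Pi.single i 1) := by
    intro i j
    let d (i : Fin m) : Derivation ℂ (MvPolynomial (Fin m) ℂ) (MvPolynomial (Fin m) ℂ) := pderiv i
    have hcomm : ⁅d i, d j⁆ = 0 := by
      refine derivation_ext fun k => ?_
      rw [Derivation.commutator_apply]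
      simp only [d, pderiv_X, Pi.single_apply]
      split_ifs <;> simp
    have := DFunLike.congr_fun hcomm q
    rw [Derivation.commutator_apply, Derivation.zero_apply, sub_eq_zero, hl, hl,
      pderiv_linPoly, pderiv_linPoly] at this
    exact (C_injective (Fin m) ℂ this).symm
  let B : LinearMap.BilinForm ℂ (Fin m → ℂ) :=
    (1 / 2 : ℂ) • ∑ i, (LinearMap.mul ℂ ℂ).compl₁₂ (l i) (LinearMap.proj i)
  have hB : ∀ v w, B v w = 1 / 2 * ∑ i, l i v * w i := fun v w => by simp [B, LinearMap.sum_apply]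
  have hdiff : ∀ v w, polyDiff q v w = 2 * B v w := fun v w => by
    simp [polyDiff_apply, hl, eval_linPoly, hB]
  refine ⟨B, fun v w => ?_, fun w => ?_, hdiff⟩
  · simp only [hB]
    congr 1
    simp only [apply_eq_sum_single (l _) v, apply_eq_sum_single (l _) w, Finset.sum_mul]
    rw [Finset.sum_comm]
    refine Finset.sum_congr rfl fun i _ => Finset.sum_congr rfl fun j _ => ?_
    rw [hsymm]
    ring
  · have := congrArg (eval w) hq.sum_X_mul_pderiv
    simp [hl, eval_linPoly] at this
    rw [hB]
    simp only [mul_comm (l _ w)]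
    rw [this]
    ring

lemma polyDiff_sum {k : ℕ} (Q : Fin k → MvPolynomial (Fin m) ℂ) (c : Fin k → ℂ) (v : Fin m → ℂ) :
    polyDiff (∑ i, c i • Q i) v = ∑ i, c i • polyDiff (Q i) v := by
  ext w
  simp [polyDiff_apply, Finset.sum_mul, Finset.mul_sum, mul_assoc]
  exact Finset.sum_comm

end Polynomials

section Quadrics

open MvPolynomial

variable {m : ℕ}

lemma pVanish_mk_iff {q : MvPolynomial (Fin m) ℂ} (hq : q.IsHomogeneous 2) {v : Fin m → ℂ}
    (hv : v ≠ 0) : PVanish q (Projectivization.mk ℂ v hv) ↔ eval v q = 0 := by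
  obtain ⟨B, -, hB, -⟩ := exists_bilin_of_isHomogeneous_two hq
  simp only [PVanish, Projectivization.submodule_mk, Submodule.mem_span_singleton]
  constructor
  · exact fun h => h v ⟨1, one_smul _ _⟩
  · rintro h _ ⟨t, rfl⟩
    rw [hB] at h ⊢
    simp [h]

lemma polyDiff_eq_zero_of_translate {q : MvPolynomial (Fin m) ℂ} (hq : q.IsHomogeneous 2)
    {z : Fin m → ℂ} (h : ∀ w, eval (z + w) q = eval w q) : polyDiff q z = 0 := by
  obtain ⟨B, hsymm, hB, hdiff⟩ := exists_bilin_of_isHomogeneous_two hq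
  ext1 i
  refine LinearMap.ext_ring ?_
  have h0 := h 0
  have h1 := h (Pi.single i 1)
  simp only [hB] at h0 h1
  simp at h0 h1
  simp [hdiff]
  linear_combination (1 / 2) * h1 - (1 / 2) * h0 - (1 / 2) * hsymm (Pi.single i 1) z

lemma eval_add_smul_of_isHomogeneous_two {q : MvPolynomial (Fin m) ℂ} (hq : q.IsHomogeneous 2)
    {v : Fin m → ℂ} (hv : eval v q = 0) (w : Fin m → ℂ) (t : ℂ) :
    eval (w + t • v) q = eval w q + t * polyDiff q v w := by
  obtain ⟨B, hsymm, hB, hdiff⟩ := exists_bilin_of_isHomogeneous_two hq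
  rw [hB] at hv
  simp [hB, hdiff, hv, hsymm w v]
  ring

lemma polyDiff_self {q : MvPolynomial (Fin m) ℂ} (hq : q.IsHomogeneous 2)
    {v : Fin m → ℂ} (hv : eval v q = 0) : polyDiff q v v = 0 := by
  obtain ⟨B, -, hB, hdiff⟩ := exists_bilin_of_isHomogeneous_two hq
  rw [hdiff, ← hB, hv, mul_zero]

lemma two_le_totalDegree {X : Set (PS m)} (hX : X.Nonempty) (hnd : Nondegenerate X)
    {p : MvPolynomial (Fin m) ℂ} (hp : p ∈ vanishingIdeal X) (h0 : p ≠ 0) :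
    2 ≤ p.totalDegree := by
  by_contra hdeg
  obtain ⟨c, l, rfl⟩ := exists_affine_of_totalDegree_le_one (p := p) (by omega)
  have hev : ∀ x ∈ X, ∀ v ∈ x.submodule, c + l v = 0 := fun x hx v hv => by
    simpa [eval_linPoly] using hp x hx v hv
  have hc : c = 0 := by
    obtain ⟨x, hx⟩ := hX
    simpa using hev x hx 0 (zero_mem _)
  have hl : l = 0 := hnd l fun x hx v hv => by simpa [hc] using hev x hx v hv
  simp [hc, hl, linPoly] at h0

lemma irreducible_of_mem_vanishingIdeal {X : Set (PS m)} (hX : ZIrreducible X)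
    (hnd : Nondegenerate X) {p : MvPolynomial (Fin m) ℂ} (hp : p ∈ vanishingIdeal X)
    (h0 : p ≠ 0) (hdeg : p.totalDegree ≤ 2) : Irreducible p := by
  have hP := vanishingIdeal_isPrime hX
  have key : ∀ a b : MvPolynomial (Fin m) ℂ, p = a * b → a ∈ vanishingIdeal X → IsUnit b := by
    intro a b hab ha
    have hab0 : a ≠ 0 ∧ b ≠ 0 := by
      rw [← mul_ne_zero_iff, ← hab]; exact h0
    have h2 := two_le_totalDegree hX.1 hnd ha hab0.1
    rw [hab, totalDegree_mul_of_isDomain hab0.1 hab0.2] at hdeg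
    have hb := totalDegree_eq_zero_iff_eq_C.1 (show b.totalDegree = 0 by omega)
    rw [hb]
    refine IsUnit.map C (IsUnit.mk0 _ fun h => hab0.2 ?_)
    rw [hb, h, C_0]
  refine ⟨fun hu => hP.ne_top (Ideal.eq_top_of_isUnit_mem _ hp hu), fun a b hab => ?_⟩
  rcases hP.mem_or_mem (hab ▸ hp) with h | h
  · exact Or.inr (key a b hab h)
  · exact Or.inl (key b a (hab.trans (mul_comm a b)) h)

lemma mem_coneIdeal_of_polyDiff_eq_zero {X : Set (PS m)} {q : MvPolynomial (Fin m) ℂ}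
    (hq : q.IsHomogeneous 2) (hqX : q ∈ vanishingIdeal X) {v : Fin m → ℂ} (hv : eval v q = 0)
    (h : polyDiff q v = 0) : q ∈ coneIdeal X v := fun x hx y hy t => by
  rw [eval_add_smul_of_isHomogeneous_two hq hv, h, hqX x hx y hy]
  simp

lemma coneIdeal_lt_of_polyDiff_ne_zero {X : Set (PS m)} (hnd : Nondegenerate X)
    {q : MvPolynomial (Fin m) ℂ} (hq : q.IsHomogeneous 2) (hqX : q ∈ vanishingIdeal X)
    {v : Fin m → ℂ} (hv : eval v q = 0) (h : polyDiff q v ≠ 0) :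
    coneIdeal X v < vanishingIdeal X := by
  refine lt_of_le_of_ne (coneIdeal_le X v) fun heq => h (hnd _ fun x hx y hy => ?_)
  rw [← heq] at hqX
  have h0 := hqX x hx y hy 0
  have h1 := hqX x hx y hy 1
  rw [eval_add_smul_of_isHomogeneous_two hq hv] at h0 h1
  linear_combination h1 - h0

/-- The quadrics through `X` singular at a point `v` of `X` are all proportional. -/
lemma exists_smul_eq_of_polyDiff_eq_zero {n : ℕ} {X : Set (PS (n + 3))} (hX : ZIrreducible X)
    (hd : DimGE X n) (hnd : Nondegenerate X) {v : Fin (n + 3) → ℂ}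
    (hlt : coneIdeal X v < vanishingIdeal X) {q r : MvPolynomial (Fin (n + 3)) ℂ}
    (hq : q.IsHomogeneous 2) (hr : r.IsHomogeneous 2) (hqJ : q ∈ coneIdeal X v)
    (hrJ : r ∈ coneIdeal X v) (hq0 : q ≠ 0) : ∃ c : ℂ, r = c • q := by
  have hirr := irreducible_of_mem_vanishingIdeal hX hnd (coneIdeal_le X v hqJ) hq0 hq.totalDegree_le
  obtain ⟨g, rfl⟩ := dvd_of_mem_of_lt_vanishingIdeal hd (coneIdeal_isPrime hX v) hlt hirr hqJ hrJ
  by_cases hg : g = 0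
  · exact ⟨0, by simp [hg]⟩
  have hdeg := hr.totalDegree_le
  rw [totalDegree_mul_of_isDomain hq0 hg, hq.totalDegree hq0] at hdeg
  refine ⟨coeff 0 g, ?_⟩
  rw [smul_eq_C_mul, mul_comm, ← totalDegree_eq_zero_iff_eq_C.1 (show g.totalDegree = 0 by omega)]

/-- Eliminating along a projection from a point of `X` produces a linear syzygy. -/
lemma exists_linear_syzygy {n : ℕ} {X : Set (PS (n + 3))} (hX : ZIrreducible X)
    (hd : DimGE X n) (hnd : Nondegenerate X) {v : Fin (n + 3) → ℂ}
    {q₀ q₁ q₂ : MvPolynomial (Fin (n + 3)) ℂ}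
    (h₀ : q₀.IsHomogeneous 2) (h₁ : q₁.IsHomogeneous 2) (h₂ : q₂.IsHomogeneous 2)
    (hX₀ : q₀ ∈ vanishingIdeal X) (hX₁ : q₁ ∈ vanishingIdeal X) (hX₂ : q₂ ∈ vanishingIdeal X)
    (hv₀ : eval v q₀ = 0) (hv₁ : eval v q₁ = 0) (hv₂ : eval v q₂ = 0)
    (hq₀ : q₀ ≠ 0) (hd₀ : polyDiff q₀ v = 0) (hd₁ : polyDiff q₁ v ≠ 0) :
    ∃ l : (Fin (n + 3) → ℂ) →ₗ[ℂ] ℂ,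
      linPoly (polyDiff q₂ v) * q₁ - linPoly (polyDiff q₁ v) * q₂ = linPoly l * q₀ := by
  have hirr := irreducible_of_mem_vanishingIdeal hX hnd hX₀ hq₀ h₀.totalDegree_le
  have hlt := coneIdeal_lt_of_polyDiff_ne_zero hnd h₁ hX₁ hv₁ hd₁
  have hF : linPoly (polyDiff q₂ v) * q₁ - linPoly (polyDiff q₁ v) * q₂ ∈ coneIdeal X v := by
    intro x hx y hy t
    simp [eval_linPoly, eval_add_smul_of_isHomogeneous_two h₁ hv₁,
      eval_add_smul_of_isHomogeneous_two h₂ hv₂, hX₁ x hx y hy, hX₂ x hx y hy,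
      polyDiff_self h₁ hv₁, polyDiff_self h₂ hv₂]
    ring
  obtain ⟨g, hg⟩ := dvd_of_mem_of_lt_vanishingIdeal hd (coneIdeal_isPrime hX v) hlt hirr
    (mem_coneIdeal_of_polyDiff_eq_zero h₀ hX₀ hv₀ hd₀) hF
  have hF3 : (linPoly (polyDiff q₂ v) * q₁ - linPoly (polyDiff q₁ v) * q₂).IsHomogeneous 3 :=
    ((isHomogeneous_linPoly _).mul h₁).sub ((isHomogeneous_linPoly _).mul h₂)
  have hgdeg : g.totalDegree ≤ 1 := by
    by_cases hg0 : g = 0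
    · simp [hg0]
    have := hF3.totalDegree_le
    rw [hg, totalDegree_mul_of_isDomain hq₀ hg0, h₀.totalDegree hq₀] at this
    omega
  obtain ⟨c, l, rfl⟩ := exists_affine_of_totalDegree_le_one hgdeg
  refine ⟨l, ?_⟩
  have hhom : (C c * q₀).IsHomogeneous 2 := h₀.C_mul c
  have hhom' : (C c * q₀).IsHomogeneous 3 := by
    have : C c * q₀ = (linPoly (polyDiff q₂ v) * q₁ - linPoly (polyDiff q₁ v) * q₂)
        - linPoly l * q₀ := by rw [hg]; ring
    rw [this]
    exact hF3.sub ((isHomogeneous_linPoly _).mul h₀)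
  have hc : C c * q₀ = 0 := by
    by_contra hne
    exact absurd (hhom.inj_right hhom' hne) (by norm_num)
  rw [hg]
  linear_combination hc

lemma syzygy_notMem_span {X : Set (PS m)} (hX : ZIrreducible X) (hnd : Nondegenerate X)
    {v : Fin m → ℂ} {q₀ q₁ q₂ : MvPolynomial (Fin m) ℂ}
    (h₀ : q₀.IsHomogeneous 2) (h₁ : q₁.IsHomogeneous 2) (h₂ : q₂.IsHomogeneous 2)
    (hX₀ : q₀ ∈ vanishingIdeal X) (hX₁ : q₁ ∈ vanishingIdeal X)
    (hd₀ : polyDiff q₀ v = 0) (hind : LinearIndependent ℂ ![polyDiff q₁ v, polyDiff q₂ v])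
    {l : (Fin m → ℂ) →ₗ[ℂ] ℂ}
    (hl : linPoly (polyDiff q₂ v) * q₁ - linPoly (polyDiff q₁ v) * q₂ = linPoly l * q₀) :
    l ∉ Submodule.span ℂ {polyDiff q₁ v, polyDiff q₂ v} := by
  have hd₁ : polyDiff q₁ v ≠ 0 := hind.ne_zero 0
  rw [Submodule.mem_span_pair]
  rintro ⟨α, β, hαβ⟩
  have hlin : linPoly l = C α * linPoly (polyDiff q₁ v) + C β * linPoly (polyDiff q₂ v) := by
    refine MvPolynomial.funext fun w => ?_
    simp [eval_linPoly, ← hαβ]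
  have hsyz : linPoly (polyDiff q₁ v) * (q₂ + C α * q₀) =
      linPoly (polyDiff q₂ v) * (q₁ - C β * q₀) := by
    rw [hlin] at hl
    linear_combination -hl
  have hG2 : (q₁ - C β * q₀).IsHomogeneous 2 := h₁.sub (h₀.C_mul β)
  have hH2 : (q₂ + C α * q₀).IsHomogeneous 2 := h₂.add (h₀.C_mul α)
  have hGX : q₁ - C β * q₀ ∈ vanishingIdeal X :=
    sub_mem hX₁ (Ideal.mul_mem_left _ _ hX₀)
  have hG0 : q₁ - C β * q₀ ≠ 0 := fun h => hd₁ (by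
    rw [sub_eq_zero, ← smul_eq_C_mul] at h
    ext1 i
    refine LinearMap.ext_ring ?_
    have := LinearMap.congr_fun hd₀ (Pi.single i 1)
    simp only [polyDiff_apply, LinearMap.zero_apply] at this
    simp [h, polyDiff_apply, mul_assoc, ← Finset.mul_sum, this])
  have hprime := (irreducible_of_mem_vanishingIdeal hX hnd hGX hG0 hG2.totalDegree_le).prime
  rcases hprime.dvd_or_dvd (Dvd.intro_left _ hsyz.symm) with hdvd | ⟨g, hg⟩
  · have hu0 : linPoly (polyDiff q₁ v) ≠ 0 := fun h => hd₁ (by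
      ext1 i
      refine LinearMap.ext_ring ?_
      simp [← eval_linPoly, h])
    have := two_le_totalDegree hX.1 hnd (Ideal.mem_of_dvd _ hdvd hGX) hu0
    have := (isHomogeneous_linPoly (polyDiff q₁ v)).totalDegree_le
    omega
  · have hgC : g = C (coeff 0 g) := by
      by_cases hg0 : g = 0
      · simp [hg0]
      have := hH2.totalDegree_le
      rw [hg, totalDegree_mul_of_isDomain hG0 hg0, hG2.totalDegree hG0] at this
      exact totalDegree_eq_zero_iff_eq_C.1 (by omega)
    have hcancel : linPoly (polyDiff q₁ v) * C (coeff 0 g) = linPoly (polyDiff q₂ v) := by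
      refine mul_right_cancel₀ hG0 ?_
      rw [← hsyz, hg, ← hgC]
      ring
    have := (LinearIndependent.pair_iff.1 hind (coeff 0 g) (-1) (by
      refine LinearMap.ext fun w => ?_
      have := congrArg (eval w) hcancel
      simp [eval_linPoly] at this ⊢
      linear_combination this)).2
    norm_num at this

/-- Three quadrics through a nondegenerate variety of codimension two, suitably chosen with respect
to one of its points, are the minors of a `2 × 3` matrix of linear forms. -/
lemma exists_minors {n : ℕ} {X : Set (PS (n + 3))} (hX : ZIrreducible X)
    (hd : DimGE X n) (hnd : Nondegenerate X) {v : Fin (n + 3) → ℂ}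
    {q₀ q₁ q₂ : MvPolynomial (Fin (n + 3)) ℂ}
    (h₀ : q₀.IsHomogeneous 2) (h₁ : q₁.IsHomogeneous 2) (h₂ : q₂.IsHomogeneous 2)
    (hX₀ : q₀ ∈ vanishingIdeal X) (hX₁ : q₁ ∈ vanishingIdeal X) (hX₂ : q₂ ∈ vanishingIdeal X)
    (hv₀ : eval v q₀ = 0) (hv₁ : eval v q₁ = 0) (hv₂ : eval v q₂ = 0)
    (hq₀ : q₀ ≠ 0) (hd₀ : polyDiff q₀ v = 0)
    (hind : LinearIndependent ℂ ![polyDiff q₁ v, polyDiff q₂ v]) :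
    ∃ l m : Fin 3 → (Fin (n + 3) → ℂ) →ₗ[ℂ] ℂ, ∀ w,
      -eval w q₀ = l 1 w * m 2 w - l 2 w * m 1 w ∧
      -eval w q₂ = l 2 w * m 0 w - l 0 w * m 2 w ∧
      eval w q₁ = l 0 w * m 1 w - l 1 w * m 0 w := by
  have hd₁ : polyDiff q₁ v ≠ 0 := hind.ne_zero 0
  obtain ⟨l, hl⟩ := exists_linear_syzygy hX hd hnd h₀ h₁ h₂ hX₀ hX₁ hX₂ hv₀ hv₁ hv₂ hq₀ hd₀ hd₁
  have hspan := syzygy_notMem_span hX hnd h₀ h₁ h₂ hX₀ hX₁ hd₀ hind hl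
  have hind3 : LinearIndependent ℂ ![l, polyDiff q₁ v, polyDiff q₂ v] := by
    refine linearIndependent_finCons.2 ⟨hind, ?_⟩
    rwa [Matrix.range_cons, Matrix.range_cons, Matrix.range_empty, Set.union_empty,
      Set.singleton_union]
  obtain ⟨e, he⟩ := exists_dual_vectors hind3
  obtain ⟨B₀, -, hB₀, -⟩ := exists_bilin_of_isHomogeneous_two h₀
  obtain ⟨B₁, -, hB₁, -⟩ := exists_bilin_of_isHomogeneous_two h₁
  obtain ⟨B₂, -, hB₂, -⟩ := exists_bilin_of_isHomogeneous_two h₂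
  obtain ⟨m, hm⟩ := exists_minors_of_syzygy ![-B₀, -B₂, B₁] _ he fun w => by
    have hw := congrArg (eval w) hl
    simp only [map_sub, map_mul, eval_linPoly, hB₀, hB₁, hB₂] at hw
    change l w * -B₀ w w + polyDiff q₁ v w * -B₂ w w + polyDiff q₂ v w * B₁ w w = 0
    linear_combination hw
  refine ⟨![l, polyDiff q₁ v, polyDiff q₂ v], m, fun w => ?_⟩
  rw [hB₀, hB₁, hB₂]
  exact hm w

end Quadrics

lemma exists_segreVec {y : Fin 6 → ℂ} (h0 : y 1 * y 5 - y 2 * y 4 = 0)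
    (h1 : y 2 * y 3 - y 0 * y 5 = 0) (h2 : y 0 * y 4 - y 1 * y 3 = 0) :
    ∃ a b, segreVec a b = y := by
  by_cases hl : ∃ i, (![y 0, y 1, y 2] : Fin 3 → ℂ) i ≠ 0
  · obtain ⟨i, hi⟩ := hl
    refine ⟨![1, ![y 3, y 4, y 5] i / ![y 0, y 1, y 2] i], ![y 0, y 1, y 2], ?_⟩
    ext k
    fin_cases i <;> fin_cases k <;> simp [segreVec, segreIdx] at hi ⊢ <;> field_simp <;>
      first
        | linear_combination h0 | linear_combination h1 | linear_combination h2
        | linear_combination -h0 | linear_combination -h1 | linear_combination -h2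
  · push Not at hl
    refine ⟨![0, 1], ![y 3, y 4, y 5], ?_⟩
    have e0 := hl 0
    have e1 := hl 1
    have e2 := hl 2
    simp at e0 e1 e2
    ext k
    fin_cases k <;> simp [segreVec, segreIdx, e0, e1, e2]

/-- A generic determinantal variety of `2 × 3` matrices of linear forms in six variables is a
Segre threefold. -/
lemma projEquiv_segre12 {X : Set (PS 6)} (l m : Fin 3 → (Fin 6 → ℂ) →ₗ[ℂ] ℂ)
    (hX : ∀ v hv, Projectivization.mk ℂ v hv ∈ X ↔
      l 1 v * m 2 v - l 2 v * m 1 v = 0 ∧ l 2 v * m 0 v - l 0 v * m 2 v = 0 ∧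
      l 0 v * m 1 v - l 1 v * m 0 v = 0)
    (hinj : ∀ v, (∀ i, l i v = 0) → (∀ i, m i v = 0) → v = 0) : ProjEquiv X Segre12 := by
  let f : (Fin 6 → ℂ) →ₗ[ℂ] (Fin 6 → ℂ) := LinearMap.pi ![l 0, l 1, l 2, m 0, m 1, m 2]
  have hf : Function.Injective f := by
    rw [injective_iff_map_eq_zero]
    intro v hv
    have hk := fun k => congrFun hv k
    refine hinj v (fun i => ?_) fun i => ?_
    · fin_cases i
      exacts [hk 0, hk 1, hk 2]
    · fin_cases i
      exacts [hk 3, hk 4, hk 5]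
  have hsurj : Function.Surjective f := LinearMap.injective_iff_surjective.1 hf
  refine ⟨f, hf, hsurj, ?_⟩
  ext y
  constructor
  · rintro ⟨x, hx, rfl⟩
    induction x using Projectivization.ind with
    | h v hv =>
      obtain ⟨h0, h1, h2⟩ := (hX v hv).1 hx
      obtain ⟨a, b, hab⟩ := exists_segreVec (y := f v) h0 h1 h2
      have hne : segreVec a b ≠ 0 := by
        rw [hab]
        exact fun h => hv (hf (h.trans (map_zero f).symm))
      refine ⟨a, b, hne, ?_⟩
      rw [Projectivization.map_mk]
      congr 1
      exact hab.symm
  · rintro ⟨a, b, hab, rfl⟩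
    obtain ⟨v, hv⟩ := hsurj (segreVec a b)
    have hv0 : v ≠ 0 := by
      rintro rfl
      exact hab (by rw [← hv, map_zero])
    refine ⟨Projectivization.mk ℂ v hv0, (hX v hv0).2 ?_, ?_⟩
    · have hk := fun k => congrFun hv k
      have e0 : l 0 v = a 0 * b 0 := hk 0
      have e1 : l 1 v = a 0 * b 1 := hk 1
      have e2 : l 2 v = a 0 * b 2 := hk 2
      have e3 : m 0 v = a 1 * b 0 := hk 3
      have e4 : m 1 v = a 1 * b 1 := hk 4
      have e5 : m 2 v = a 1 * b 2 := hk 5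
      rw [e0, e1, e2, e3, e4, e5]
      refine ⟨?_, ?_, ?_⟩ <;> ring
    · rw [Projectivization.map_mk]
      congr 1

/-- The rank of the differentials of equations cutting out `X` is the codimension of the tangent
space. -/
lemma finrank_range_differentials {m k n : ℕ} {X : Set (PS m)} {Q : Fin k → MvPolynomial (Fin m) ℂ}
    (hQ : SchemeCutOutBy X Q) {x : PS m} (hx : x ∈ X)
    (ht : Module.finrank ℂ (tangentSubmodule X x) = n) :
    Module.finrank ℂ (LinearMap.range
      (Fintype.linearCombination ℂ fun i => polyDiff (Q i) x.rep)) + n = m := by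
  have htan : tangentSubmodule X x = (LinearMap.range
      (Fintype.linearCombination ℂ fun i => polyDiff (Q i) x.rep)).dualCoannihilator := by
    rw [Fintype.range_linearCombination]
    refine le_antisymm (fun w hw => ?_) (le_trans ?_ (le_iInf₂ (hQ.2 x hx)))
    · have hwQ : ∀ i, polyDiff (Q i) x.rep w = 0 := fun i => by
        have := Submodule.mem_iInf _ |>.1 (Submodule.mem_iInf _ |>.1 hw (Q i)) fun y hy => by
          rw [hQ.1] at hy
          exact hy i
        exact this
      rw [Submodule.mem_dualCoannihilator]
      intro φ hφ
      induction hφ using Submodule.span_induction with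
      | mem φ h => obtain ⟨i, rfl⟩ := h; exact hwQ i
      | zero => simp
      | add φ ψ _ _ h h' => simp [h, h']
      | smul c φ _ h => simp [h]
    · intro w hw
      rw [Submodule.mem_dualCoannihilator] at hw
      exact Submodule.mem_iInf _ |>.2 fun i => hw _ (Submodule.subset_span ⟨i, rfl⟩)
  have := Subspace.finrank_add_finrank_dualCoannihilator_eq (LinearMap.range
      (Fintype.linearCombination ℂ fun i => polyDiff (Q i) x.rep))
  rw [← htan, ht] at this
  simpa using this

lemma projEquiv_segre12_of_cutOutByQuadrics {X : Set (PS 6)} (hX : SmoothVariety X 3)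
    (hnd : Nondegenerate X) (hci : ¬ IsCompleteIntersection X 3) {k : ℕ}
    {Q : Fin k → MvPolynomial (Fin 6) ℂ} (hQ2 : ∀ i, (Q i).IsHomogeneous 2)
    (hQind : LinearIndependent ℂ Q) (hQ : SchemeCutOutBy X Q) : ProjEquiv X Segre12 := by
  obtain ⟨-, hirr, ⟨hd, -⟩, htan⟩ := hX
  obtain ⟨x, hx⟩ := hirr.1
  let q : (Fin k → ℂ) → MvPolynomial (Fin 6) ℂ := fun c => ∑ i, c i • Q i
  have hq2 : ∀ c, (q c).IsHomogeneous 2 := fun c =>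
    MvPolynomial.IsHomogeneous.sum _ _ _ fun i _ => by
      rw [MvPolynomial.smul_eq_C_mul]
      exact (hQ2 i).C_mul _
  have hQX : ∀ i, Q i ∈ vanishingIdeal X := fun i y hy => by
    rw [hQ.1] at hy
    exact hy i
  have hqX : ∀ c, q c ∈ vanishingIdeal X := fun c =>
    sum_mem fun i _ => by
      rw [MvPolynomial.smul_eq_C_mul]
      exact Ideal.mul_mem_left _ _ (hQX i)
  have hq0 : ∀ c, q c = 0 → c = 0 := fun c hc =>
    funext fun i => Fintype.linearIndependent_iff.1 hQind c hc i
  have hxq : ∀ c, MvPolynomial.eval x.rep (q c) = 0 := fun c =>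
    hqX c x hx _ (by rw [Projectivization.submodule_eq]; exact Submodule.mem_span_singleton_self _)
  let D := Fintype.linearCombination ℂ fun i => polyDiff (Q i) x.rep
  have hD : ∀ c, polyDiff (q c) x.rep = D c := fun c => by
    rw [polyDiff_sum, Fintype.linearCombination_apply]
  have hrange : Module.finrank ℂ (LinearMap.range D) = 2 := by
    have : Module.finrank ℂ (LinearMap.range D) + (3 + 1) = 6 :=
      finrank_range_differentials hQ hx (htan x hx)
    omega
  have hrn := D.finrank_range_add_finrank_ker
  rw [hrange, Module.finrank_fin_fun] at hrn
  have hk : k ≠ 2 := by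
    rintro rfl
    exact hci ⟨Q, fun _ => 2, hQ2, fun _ => one_le_two, hQ⟩
  obtain ⟨⟨c₀, hc₀⟩, hc₀ne⟩ := Module.finrank_pos_iff_exists_ne_zero.1
    (show 0 < Module.finrank ℂ (LinearMap.ker D) by omega)
  have hc₀0 : c₀ ≠ 0 := fun h => hc₀ne (Subtype.ext h)
  rw [LinearMap.mem_ker] at hc₀
  let b := Module.finBasisOfFinrankEq ℂ (LinearMap.range D) hrange
  obtain ⟨c₁, hc₁⟩ := (b 0).2
  obtain ⟨c₂, hc₂⟩ := (b 1).2
  have hind : LinearIndependent ℂ ![polyDiff (q c₁) x.rep, polyDiff (q c₂) x.rep] := by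
    have hb : ![polyDiff (q c₁) x.rep, polyDiff (q c₂) x.rep] = (LinearMap.range D).subtype ∘ b := by
      rw [hD, hD, hc₁, hc₂]
      ext i
      fin_cases i <;> rfl
    rw [hb]
    exact b.linearIndependent.map' (LinearMap.range D).subtype (Submodule.ker_subtype _)
  have hker : ∀ c, D c = 0 → ∃ a : ℂ, c = a • c₀ := by
    intro c hc
    have hmem : ∀ c, D c = 0 → q c ∈ coneIdeal X x.rep := fun c hc =>
      mem_coneIdeal_of_polyDiff_eq_zero (hq2 c) (hqX c) (hxq c) ((hD c).trans hc)
    obtain ⟨a, ha⟩ := exists_smul_eq_of_polyDiff_eq_zero hirr hd hnd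
      (coneIdeal_lt_of_polyDiff_ne_zero hnd (hq2 c₁) (hqX c₁) (hxq c₁) (hind.ne_zero 0))
      (hq2 c₀) (hq2 c) (hmem c₀ hc₀) (hmem c hc) fun h => hc₀0 (hq0 _ h)
    refine ⟨a, sub_eq_zero.1 (hq0 _ ?_)⟩
    simp only [q] at ha ⊢
    simp [sub_smul, Finset.sum_sub_distrib, ha, Finset.smul_sum, smul_smul]
  have hspan : ∀ c, ∃ a₀ a₁ a₂ : ℂ, c = a₀ • c₀ + a₁ • c₁ + a₂ • c₂ := by
    intro c
    have hrepr := b.sum_repr ⟨D c, c, rfl⟩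
    rw [Fin.sum_univ_two] at hrepr
    have hrepr' := congrArg Subtype.val hrepr
    simp only [Submodule.coe_add, Submodule.coe_smul, ← hc₁, ← hc₂] at hrepr'
    obtain ⟨a, ha⟩ := hker (c - _ • c₁ - _ • c₂) (by
      rw [map_sub, map_sub, map_smul, map_smul, ← hrepr']
      abel)
    exact ⟨a, _, _, by rw [← ha]; abel⟩
  have heval : ∀ c w, MvPolynomial.eval w (q c) = ∑ i, c i * MvPolynomial.eval w (Q i) :=
    fun c w => by simp [q]
  have hQeval : ∀ i, ∃ a₀ a₁ a₂ : ℂ, ∀ w, MvPolynomial.eval w (Q i) =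
      a₀ * MvPolynomial.eval w (q c₀) + a₁ * MvPolynomial.eval w (q c₁) +
        a₂ * MvPolynomial.eval w (q c₂) := by
    intro i
    obtain ⟨a₀, a₁, a₂, h⟩ := hspan (Pi.single i 1)
    refine ⟨a₀, a₁, a₂, fun w => ?_⟩
    have : MvPolynomial.eval w (Q i) = MvPolynomial.eval w (q (Pi.single i 1)) := by
      simp [heval, Pi.single_apply]
    rw [this, h]
    simp only [heval, Pi.add_apply, Pi.smul_apply, smul_eq_mul, add_mul, Finset.sum_add_distrib,
      Finset.mul_sum, mul_assoc]
  obtain ⟨l, m, hlm⟩ := exists_minors hirr hd hnd (hq2 c₀) (hq2 c₁) (hq2 c₂) (hqX c₀) (hqX c₁)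
    (hqX c₂) (hxq c₀) (hxq c₁) (hxq c₂) (fun h => hc₀0 (hq0 _ h)) ((hD c₀).trans hc₀) hind
  have hmem : ∀ v hv, Projectivization.mk ℂ v hv ∈ X ↔
      l 1 v * m 2 v - l 2 v * m 1 v = 0 ∧ l 2 v * m 0 v - l 0 v * m 2 v = 0 ∧
      l 0 v * m 1 v - l 1 v * m 0 v = 0 := by
    intro v hv
    obtain ⟨h0, h1, h2⟩ := hlm v
    rw [← h0, ← h1, ← h2, neg_eq_zero, neg_eq_zero]
    constructor
    · intro h
      have := fun c => (pVanish_mk_iff (hq2 c) hv).1 (hqX c _ h)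
      exact ⟨this _, this _, this _⟩
    · rintro ⟨e0, e2, e1⟩
      rw [hQ.1]
      intro i
      rw [pVanish_mk_iff (hQ2 i)]
      obtain ⟨a₀, a₁, a₂, h⟩ := hQeval i
      simp [h, e0, e1, e2]
  refine projEquiv_segre12 l m hmem fun v hlv hmv => ?_
  by_contra hv
  let z := Projectivization.mk ℂ v hv
  have hz : z ∈ X := (hmem v hv).2 (by simp [hlv])
  obtain ⟨a, ha⟩ := Projectivization.exists_smul_eq_mk_rep ℂ v hv
  have hdz : ∀ i, polyDiff (Q i) z.rep = 0 := fun i =>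
    polyDiff_eq_zero_of_translate (hQ2 i) fun w => by
      obtain ⟨a₀, a₁, a₂, h⟩ := hQeval i
      have hlz : ∀ j, l j z.rep = 0 := fun j => by rw [← ha, Units.smul_def]; simp [hlv]
      have hmz : ∀ j, m j z.rep = 0 := fun j => by rw [← ha, Units.smul_def]; simp [hmv]
      obtain ⟨h0, h1, h2⟩ := hlm (z.rep + w)
      obtain ⟨h0', h1', h2'⟩ := hlm w
      simp only [map_add, hlz, hmz, zero_add] at h0 h1 h2
      rw [h, h]
      linear_combination a₀ * (h0' - h0) + a₁ * (h2 - h2') + a₂ * (h1' - h1)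
  have := finrank_range_differentials hQ hz (htan z hz)
  have hzero : (Fintype.linearCombination ℂ fun i => polyDiff (Q i) z.rep) = 0 := by
    refine LinearMap.ext fun c => ?_
    simp [Fintype.linearCombination_apply, hdz]
  rw [hzero, LinearMap.range_zero, finrank_bot] at this
  omega

end PaperQV

/-- If `(n, c) = (3, 2)`, a nondegenerate smooth projective quadratic 3-fold in
`ℙ⁵` which is not a complete intersection is projectively equivalent to the
Segre 3-fold `ℙ¹ × ℙ² ⊆ ℙ⁵`. -/
theorem segre_case (X : Set (PS (3 + 2 + 1)))
    (hsm : SmoothVariety X 3) (hnd : Nondegenerate X) (hq : IsQuadratic X)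
    (hci : ¬ IsCompleteIntersection X 3) :
    ProjEquiv X Segre12 := by
  obtain ⟨k, Q, hQ2, hQind, hQ⟩ := hq
  exact projEquiv_segre12_of_cutOutByQuadrics hsm hnd hci hQ2 hQind hQ
end
end

section
/- Let V be a smooth hyperplane section of the 10-dimensional spinor variety S^{10} ⊂ ℙ^{15}. Then V ⊂ ℙ^{14} is not scheme-theoretically defined by 8 quadric hypersurfaces. -/
/-!
Common framework for formalizing "Quadratic Varieties of Small Codimension"
(K. Watanabe), following Ionescu–Russo.

We model a projective variety as a subset of the complex projective space
`PS m := ℙ ℂ (Fin m → ℂ)` (which is `ℙ^{m-1}`, with `m` homogeneous coordinates).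
-/

noncomputable section

open scoped BigOperators

open PaperQV

namespace SpinorClifford

/-- Clifford multiplication by `w ∈ ℂ¹⁰` on half-spinors. Half-spinors of both chiralities are
written in dual weight bases, so that multiplication by `w` is a symmetric matrix. -/
def cliff {R : Type*} [CommRing R] (w : Fin 10 → R) (s : Fin 16 → R) : Fin 16 → R
  | 0 => w 0 * s 11 + w 1 * s 12 + w 2 * s 13 + w 3 * s 14 + w 4 * s 15
  | 1 => -w 2 * s 10 - w 3 * s 9 - w 4 * s 8 - w 5 * s 12 + w 6 * s 11
  | 2 => -w 1 * s 10 + w 3 * s 7 + w 4 * s 6 + w 5 * s 13 - w 7 * s 11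
  | 3 => w 1 * s 9 + w 2 * s 7 - w 4 * s 5 - w 5 * s 14 + w 8 * s 11
  | 4 => -w 1 * s 8 - w 2 * s 6 - w 3 * s 5 + w 5 * s 15 - w 9 * s 11
  | 5 => -w 0 * s 10 - w 3 * s 4 - w 4 * s 3 - w 6 * s 13 + w 7 * s 12
  | 6 => w 0 * s 9 - w 2 * s 4 + w 4 * s 2 + w 6 * s 14 - w 8 * s 12
  | 7 => -w 0 * s 8 + w 2 * s 3 + w 3 * s 2 - w 6 * s 15 + w 9 * s 12
  | 8 => -w 0 * s 7 - w 1 * s 4 - w 4 * s 1 - w 7 * s 14 + w 8 * s 13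
  | 9 => w 0 * s 6 + w 1 * s 3 - w 3 * s 1 + w 7 * s 15 - w 9 * s 13
  | 10 => -w 0 * s 5 - w 1 * s 2 - w 2 * s 1 - w 8 * s 15 + w 9 * s 14
  | 11 => w 0 * s 0 + w 6 * s 1 - w 7 * s 2 + w 8 * s 3 - w 9 * s 4
  | 12 => w 1 * s 0 - w 5 * s 1 + w 7 * s 5 - w 8 * s 6 + w 9 * s 7
  | 13 => w 2 * s 0 + w 5 * s 2 - w 6 * s 5 + w 8 * s 8 - w 9 * s 9
  | 14 => w 3 * s 0 - w 5 * s 3 + w 6 * s 6 - w 7 * s 8 + w 9 * s 10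
  | 15 => w 4 * s 0 + w 5 * s 4 - w 6 * s 7 + w 7 * s 9 - w 8 * s 10
  | ⟨n + 16, h⟩ => absurd h (by omega)

/-- The ten quadratic equations of the spinor variety. -/
def quad {R : Type*} [CommRing R] (s : Fin 16 → R) : Fin 10 → R
  | 0 => s 0 * s 11 - s 5 * s 10 + s 6 * s 9 - s 7 * s 8
  | 1 => s 0 * s 12 - s 2 * s 10 + s 3 * s 9 - s 4 * s 8
  | 2 => s 0 * s 13 - s 1 * s 10 + s 3 * s 7 - s 4 * s 6
  | 3 => s 0 * s 14 - s 1 * s 9 + s 2 * s 7 - s 4 * s 5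
  | 4 => s 0 * s 15 - s 1 * s 8 + s 2 * s 6 - s 3 * s 5
  | 5 => -s 1 * s 12 + s 2 * s 13 - s 3 * s 14 + s 4 * s 15
  | 6 => s 1 * s 11 - s 5 * s 13 + s 6 * s 14 - s 7 * s 15
  | 7 => -s 2 * s 11 + s 5 * s 12 - s 8 * s 14 + s 9 * s 15
  | 8 => s 3 * s 11 - s 6 * s 12 + s 8 * s 13 - s 10 * s 15
  | 9 => -s 4 * s 11 + s 7 * s 12 - s 9 * s 13 + s 10 * s 14

/-- The polarization of `quad`. -/
def quadPolar {R : Type*} [CommRing R] (s t : Fin 16 → R) : Fin 10 → R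
  | 0 => s 0 * t 11 + s 11 * t 0 - s 5 * t 10 - s 10 * t 5 +
    s 6 * t 9 + s 9 * t 6 - s 7 * t 8 - s 8 * t 7
  | 1 => s 0 * t 12 + s 12 * t 0 - s 2 * t 10 - s 10 * t 2 +
    s 3 * t 9 + s 9 * t 3 - s 4 * t 8 - s 8 * t 4
  | 2 => s 0 * t 13 + s 13 * t 0 - s 1 * t 10 - s 10 * t 1 +
    s 3 * t 7 + s 7 * t 3 - s 4 * t 6 - s 6 * t 4
  | 3 => s 0 * t 14 + s 14 * t 0 - s 1 * t 9 - s 9 * t 1 +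
    s 2 * t 7 + s 7 * t 2 - s 4 * t 5 - s 5 * t 4
  | 4 => s 0 * t 15 + s 15 * t 0 - s 1 * t 8 - s 8 * t 1 +
    s 2 * t 6 + s 6 * t 2 - s 3 * t 5 - s 5 * t 3
  | 5 => -s 1 * t 12 - s 12 * t 1 + s 2 * t 13 + s 13 * t 2 -
    s 3 * t 14 - s 14 * t 3 + s 4 * t 15 + s 15 * t 4
  | 6 => s 1 * t 11 + s 11 * t 1 - s 5 * t 13 - s 13 * t 5 +
    s 6 * t 14 + s 14 * t 6 - s 7 * t 15 - s 15 * t 7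
  | 7 => -s 2 * t 11 - s 11 * t 2 + s 5 * t 12 + s 12 * t 5 -
    s 8 * t 14 - s 14 * t 8 + s 9 * t 15 + s 15 * t 9
  | 8 => s 3 * t 11 + s 11 * t 3 - s 6 * t 12 - s 12 * t 6 +
    s 8 * t 13 + s 13 * t 8 - s 10 * t 15 - s 15 * t 10
  | 9 => -s 4 * t 11 - s 11 * t 4 + s 7 * t 12 + s 12 * t 7 -
    s 9 * t 13 - s 13 * t 9 + s 10 * t 14 + s 14 * t 10

/-- The exchange of the two halves of a hyperbolic basis of `ℂ¹⁰`; the invariant quadratic form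
is `z ↦ z ⬝ᵥ flip z`, up to a factor `2`. -/
def flip {R : Type*} (w : Fin 10 → R) : Fin 10 → R
  | 0 => w 5
  | 1 => w 6
  | 2 => w 7
  | 3 => w 8
  | 4 => w 9
  | 5 => w 0
  | 6 => w 1
  | 7 => w 2
  | 8 => w 3
  | 9 => w 4

theorem flip_flip {R : Type*} (w : Fin 10 → R) : flip (flip w) = w := by
  funext i; fin_cases i <;> rfl

variable {R : Type*} [CommRing R]

theorem flip_add (v w : Fin 10 → R) : flip (v + w) = flip v + flip w := by
  funext i; fin_cases i <;> rfl

theorem flip_smul (c : R) (w : Fin 10 → R) : flip (c • w) = c • flip w := by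
  funext i; fin_cases i <;> rfl

theorem dotProduct_flip_comm (v w : Fin 10 → R) : v ⬝ᵥ flip w = w ⬝ᵥ flip v := by
  simp [dotProduct, Fin.sum_univ_succ, flip]; ring

theorem cliff_add_left (v w : Fin 10 → R) (s : Fin 16 → R) :
    cliff (v + w) s = cliff v s + cliff w s := by
  funext i; fin_cases i <;> simp [cliff] <;> ring

theorem cliff_smul_left (c : R) (w : Fin 10 → R) (s : Fin 16 → R) :
    cliff (c • w) s = c • cliff w s := by
  funext i; fin_cases i <;> simp [cliff] <;> ring

theorem cliff_add (w : Fin 10 → R) (s t : Fin 16 → R) :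
    cliff w (s + t) = cliff w s + cliff w t := by
  funext i; fin_cases i <;> simp [cliff] <;> ring

theorem cliff_smul (c : R) (w : Fin 10 → R) (s : Fin 16 → R) :
    cliff w (c • s) = c • cliff w s := by
  funext i; fin_cases i <;> simp [cliff] <;> ring

theorem dotProduct_cliff (w : Fin 10 → R) (s t : Fin 16 → R) :
    s ⬝ᵥ cliff w t = w ⬝ᵥ quadPolar s t := by
  simp [dotProduct, Fin.sum_univ_succ, cliff, quadPolar]; ring

theorem quadPolar_comm (s t : Fin 16 → R) : quadPolar s t = quadPolar t s := by
  funext i; fin_cases i <;> simp [quadPolar] <;> ring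

theorem quadPolar_self (s : Fin 16 → R) : quadPolar s s = (2 : R) • quad s := by
  funext i; fin_cases i <;> simp [quadPolar, quad] <;> ring

theorem quadPolar_smul_right (c : R) (s t : Fin 16 → R) :
    quadPolar s (c • t) = c • quadPolar s t := by
  funext i; fin_cases i <;> simp [quadPolar] <;> ring

theorem quad_add (s t : Fin 16 → R) : quad (s + t) = quad s + quadPolar s t + quad t := by
  funext i; fin_cases i <;> simp [quadPolar, quad] <;> ring

theorem quad_smul (c : R) (s : Fin 16 → R) : quad (c • s) = c ^ 2 • quad s := by
  funext i; fin_cases i <;> simp [quad] <;> ring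

set_option maxHeartbeats 1000000 in
theorem cliff_cliff (v w : Fin 10 → R) (s : Fin 16 → R) :
    cliff v (cliff w s) + cliff (flip w) (cliff (flip v) s) = (v ⬝ᵥ w) • s := by
  rw [show v ⬝ᵥ w = v 0 * w 0 + v 1 * w 1 + v 2 * w 2 + v 3 * w 3 + v 4 * w 4 + v 5 * w 5 +
    v 6 * w 6 + v 7 * w 7 + v 8 * w 8 + v 9 * w 9 by
      simp only [dotProduct, Fin.sum_univ_succ]; simp; ring]
  funext i
  fin_cases i <;> simp [cliff, flip] <;> ring

theorem cliff_flip_quad (s : Fin 16 → R) : cliff (flip (quad s)) s = 0 := by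
  funext i; fin_cases i <;> simp [cliff, flip, quad] <;> ring

theorem cliff_map {S : Type*} [CommRing S] (f : R →+* S) (w : Fin 10 → R) (s : Fin 16 → R) :
    cliff (f ∘ w) (f ∘ s) = f ∘ cliff w s := by
  funext i; fin_cases i <;> simp [cliff]

theorem single_eq_map_single {n : ℕ} (i : Fin n) :
    (Pi.single i 1 : Fin n → R) = Int.castRingHom R ∘ Pi.single i 1 := by
  funext k; by_cases h : k = i <;> simp [h]

/-- Five of the eight weight vectors in the range of multiplication by a basis vector of `ℂ¹⁰`. -/
def rangeWeights : Fin 10 → Fin 5 → Fin 16 :=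
  ![![11, 10, 9, 8, 7], ![12, 10, 9, 8, 4], ![13, 10, 7, 6, 4], ![14, 9, 7, 5, 4],
    ![15, 8, 6, 5, 3], ![12, 13, 14, 15, 1], ![11, 13, 14, 15, 1], ![11, 12, 14, 15, 2],
    ![11, 12, 13, 15, 3], ![11, 12, 13, 14, 4]]

theorem rangeWeights_injective (j : Fin 10) : Function.Injective (rangeWeights j) := by
  fin_cases j <;> decide

theorem cliff_single_cliff_single (j : Fin 10) (i : Fin 5) :
    cliff (Pi.single j 1) (cliff (Pi.single j 1) (Pi.single (rangeWeights j i) 1)) =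
      (Pi.single (rangeWeights j i) 1 : Fin 16 → R) := by
  have h : ∀ (j : Fin 10) (i : Fin 5), ∀ k,
      cliff (Pi.single j 1) (cliff (Pi.single j 1) (Pi.single (rangeWeights j i) 1)) k =
        (Pi.single (rangeWeights j i) 1 : Fin 16 → ℤ) k := by
    decide +kernel
  simp only [single_eq_map_single (R := R), cliff_map]
  rw [funext (h j i)]

theorem dotProduct_sixteen (s t : Fin 16 → R) :
    s ⬝ᵥ t = s 0 * t 0 + s 1 * t 1 + s 2 * t 2 + s 3 * t 3 + s 4 * t 4 + s 5 * t 5 +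
    s 6 * t 6 + s 7 * t 7 + s 8 * t 8 + s 9 * t 9 + s 10 * t 10 + s 11 * t 11 +
    s 12 * t 12 + s 13 * t 13 + s 14 * t 14 + s 15 * t 15 := by
  simp only [dotProduct, Fin.sum_univ_succ]; simp; ring

/-- A product of five Clifford multiplications taking a weight vector to the dual one. -/
theorem exists_dotProduct_cliff_eq_sq (k : Fin 16) : ∃ v₁ v₂ v₃ v₄ v₅ : Fin 10 → R,
    ∀ s, s ⬝ᵥ cliff v₁ (cliff v₂ (cliff v₃ (cliff v₄ (cliff v₅ s)))) = s k ^ 2 := by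
  fin_cases k
  · exact ⟨Pi.single 0 1, Pi.single 6 1, Pi.single 2 1, Pi.single 8 1, Pi.single 4 1,
      fun s => by simp [dotProduct_sixteen, cliff, sq]⟩
  · exact ⟨-Pi.single 2 1, Pi.single 0 1, Pi.single 3 1, Pi.single 1 1, Pi.single 4 1,
      fun s => by simp [dotProduct_sixteen, cliff, sq]⟩
  · exact ⟨Pi.single 1 1, Pi.single 0 1, Pi.single 3 1, Pi.single 2 1, Pi.single 4 1,
      fun s => by simp [dotProduct_sixteen, cliff, sq]⟩
  · exact ⟨-Pi.single 1 1, Pi.single 0 1, Pi.single 2 1, Pi.single 3 1, Pi.single 4 1,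
      fun s => by simp [dotProduct_sixteen, cliff, sq]⟩
  · exact ⟨Pi.single 1 1, Pi.single 0 1, Pi.single 2 1, Pi.single 4 1, Pi.single 3 1,
      fun s => by simp [dotProduct_sixteen, cliff, sq]⟩
  · exact ⟨-Pi.single 0 1, Pi.single 1 1, Pi.single 3 1, Pi.single 2 1, Pi.single 4 1,
      fun s => by simp [dotProduct_sixteen, cliff, sq]⟩
  · exact ⟨Pi.single 0 1, Pi.single 1 1, Pi.single 2 1, Pi.single 3 1, Pi.single 4 1,
      fun s => by simp [dotProduct_sixteen, cliff, sq]⟩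
  · exact ⟨-Pi.single 0 1, Pi.single 1 1, Pi.single 2 1, Pi.single 4 1, Pi.single 3 1,
      fun s => by simp [dotProduct_sixteen, cliff, sq]⟩
  · exact ⟨-Pi.single 0 1, Pi.single 2 1, Pi.single 1 1, Pi.single 3 1, Pi.single 4 1,
      fun s => by simp [dotProduct_sixteen, cliff, sq]⟩
  · exact ⟨Pi.single 0 1, Pi.single 2 1, Pi.single 1 1, Pi.single 4 1, Pi.single 3 1,
      fun s => by simp [dotProduct_sixteen, cliff, sq]⟩
  · exact ⟨-Pi.single 0 1, Pi.single 3 1, Pi.single 1 1, Pi.single 4 1, Pi.single 2 1,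
      fun s => by simp [dotProduct_sixteen, cliff, sq]⟩
  · exact ⟨Pi.single 0 1, Pi.single 1 1, Pi.single 7 1, Pi.single 3 1, Pi.single 9 1,
      fun s => by simp [dotProduct_sixteen, cliff, sq]⟩
  · exact ⟨-Pi.single 1 1, Pi.single 0 1, Pi.single 7 1, Pi.single 3 1, Pi.single 9 1,
      fun s => by simp [dotProduct_sixteen, cliff, sq]⟩
  · exact ⟨Pi.single 2 1, Pi.single 0 1, Pi.single 6 1, Pi.single 3 1, Pi.single 9 1,
      fun s => by simp [dotProduct_sixteen, cliff, sq]⟩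
  · exact ⟨-Pi.single 3 1, Pi.single 0 1, Pi.single 6 1, Pi.single 2 1, Pi.single 9 1,
      fun s => by simp [dotProduct_sixteen, cliff, sq]⟩
  · exact ⟨Pi.single 4 1, Pi.single 0 1, Pi.single 6 1, Pi.single 2 1, Pi.single 8 1,
      fun s => by simp [dotProduct_sixteen, cliff, sq]⟩

theorem exists_cliff_cliff_apply_zero (k : Fin 16) (h₀ : k ≠ 0) (h₁ : k < 11) :
    ∃ v w : Fin 10 → R, ∀ s, cliff v (cliff w s) 0 = s k := by
  fin_cases k
  · exact absurd rfl h₀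
  · exact ⟨Pi.single 0 1, Pi.single 6 1, fun s => by simp [cliff]⟩
  · exact ⟨-Pi.single 0 1, Pi.single 7 1, fun s => by simp [cliff]⟩
  · exact ⟨Pi.single 0 1, Pi.single 8 1, fun s => by simp [cliff]⟩
  · exact ⟨-Pi.single 0 1, Pi.single 9 1, fun s => by simp [cliff]⟩
  · exact ⟨Pi.single 1 1, Pi.single 7 1, fun s => by simp [cliff]⟩
  · exact ⟨-Pi.single 1 1, Pi.single 8 1, fun s => by simp [cliff]⟩
  · exact ⟨Pi.single 1 1, Pi.single 9 1, fun s => by simp [cliff]⟩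
  · exact ⟨Pi.single 2 1, Pi.single 8 1, fun s => by simp [cliff]⟩
  · exact ⟨-Pi.single 2 1, Pi.single 9 1, fun s => by simp [cliff]⟩
  · exact ⟨Pi.single 3 1, Pi.single 9 1, fun s => by simp [cliff]⟩
  all_goals exact absurd h₁ (by decide)

theorem exists_cliff_cliff_apply_mid (k : Fin 16) (h₁ : ¬ k < 11) :
    ∃ (v w : Fin 10 → R) (l : Fin 16), l ≠ 0 ∧ l < 11 ∧ ∀ s, cliff v (cliff w s) l = s k := by
  fin_cases k
  iterate 11 exact absurd (by decide) h₁
  · exact ⟨Pi.single 3 1, Pi.single 9 1, 5, by decide, by decide, fun s => by simp [cliff]⟩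
  · exact ⟨Pi.single 3 1, Pi.single 9 1, 2, by decide, by decide, fun s => by simp [cliff]⟩
  · exact ⟨Pi.single 3 1, Pi.single 9 1, 1, by decide, by decide, fun s => by simp [cliff]⟩
  · exact ⟨-Pi.single 2 1, Pi.single 9 1, 1, by decide, by decide, fun s => by simp [cliff]⟩
  · exact ⟨Pi.single 2 1, Pi.single 8 1, 1, by decide, by decide, fun s => by simp [cliff]⟩

theorem dotProduct_cliff_comm (w : Fin 10 → R) (s t : Fin 16 → R) :
    s ⬝ᵥ cliff w t = t ⬝ᵥ cliff w s := by
  rw [dotProduct_cliff, dotProduct_cliff, quadPolar_comm]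

theorem quad_zero : quad (0 : Fin 16 → R) = 0 := by
  simpa using quad_smul (0 : R) 0

theorem quadPolar_add_right (s t u : Fin 16 → R) :
    quadPolar s (t + u) = quadPolar s t + quadPolar s u := by
  refine dotProduct_eq _ _ fun v => ?_
  rw [dotProduct_comm, ← dotProduct_cliff, add_dotProduct, dotProduct_comm _ v,
    dotProduct_comm _ v, ← dotProduct_cliff, ← dotProduct_cliff, cliff_add, dotProduct_add]

theorem dotProduct_cliff_self (w : Fin 10 → R) (s : Fin 16 → R) :
    s ⬝ᵥ cliff w s = 2 * (w ⬝ᵥ quad s) := by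
  rw [dotProduct_cliff, quadPolar_self, dotProduct_smul, smul_eq_mul]

theorem quad_dotProduct_flip_quad (s : Fin 16 → ℂ) : quad s ⬝ᵥ flip (quad s) = 0 := by
  have h := dotProduct_cliff_self (flip (quad s)) s
  rw [cliff_flip_quad, dotProduct_zero, dotProduct_comm] at h
  simpa using h.symm

/-- Clifford multiplications by `v` and `w` anticommute up to their inner product. -/
theorem dotProduct_cliff_cliff (v w : Fin 10 → ℂ) (s t : Fin 16 → ℂ) :
    s ⬝ᵥ cliff v (cliff w t) =
      (v ⬝ᵥ w) * (s ⬝ᵥ t) - s ⬝ᵥ cliff (flip w) (cliff (flip v) t) := by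
  have h := congrArg (s ⬝ᵥ ·) (cliff_cliff v w t)
  simp only [dotProduct_add, dotProduct_smul, smul_eq_mul] at h
  linear_combination h

theorem cliff_flip_cliff (w : Fin 10 → ℂ) (s : Fin 16 → ℂ) :
    cliff (flip w) (cliff w s) = ((w ⬝ᵥ flip w) / 2) • s := by
  have h := cliff_cliff (flip w) w s
  rw [flip_flip, ← two_smul ℂ, dotProduct_comm] at h
  rw [div_eq_inv_mul, mul_smul, ← h, smul_smul]
  norm_num

theorem quad_cliff (w : Fin 10 → ℂ) (s : Fin 16 → ℂ) :
    quad (cliff w s) = (w ⬝ᵥ quad s) • w - ((w ⬝ᵥ flip w) / 2) • flip (quad s) := by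
  refine dotProduct_eq _ _ fun v => ?_
  have h₁ := dotProduct_cliff_self v (cliff w s)
  rw [dotProduct_cliff_cliff, dotProduct_cliff_comm (flip w), cliff_flip_cliff,
    dotProduct_comm (cliff w s) s, dotProduct_smul, dotProduct_comm (cliff _ _),
    dotProduct_cliff_self, dotProduct_cliff_self] at h₁
  have h₂ : flip v ⬝ᵥ quad s = v ⬝ᵥ flip (quad s) := by
    rw [dotProduct_comm, dotProduct_flip_comm]
  rw [h₂, smul_eq_mul] at h₁
  rw [dotProduct_comm, dotProduct_comm _ v, dotProduct_sub, dotProduct_smul, dotProduct_smul,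
    smul_eq_mul, smul_eq_mul]
  linear_combination -h₁ / 2

theorem quad_cliff_of_null {w : Fin 10 → ℂ} (hw : w ⬝ᵥ flip w = 0) (s : Fin 16 → ℂ) :
    quad (cliff w s) = (w ⬝ᵥ quad s) • w := by
  rw [quad_cliff, hw]; simp

theorem quad_cliff_of_pure {s : Fin 16 → ℂ} (hs : quad s = 0) (w : Fin 10 → ℂ) :
    quad (cliff w s) = 0 := by
  rw [quad_cliff, hs]
  simp only [dotProduct_zero, zero_smul, zero_sub, neg_eq_zero]
  have : flip (0 : Fin 10 → ℂ) = 0 := by simpa using flip_smul (0 : ℂ) 0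
  rw [this, smul_zero]

theorem quadPolar_cliff_quad (s t : Fin 16 → ℂ) :
    quadPolar s (cliff (quad s) t) = (s ⬝ᵥ t) • quad s := by
  refine dotProduct_eq _ _ fun v => ?_
  rw [dotProduct_comm, ← dotProduct_cliff, dotProduct_cliff_cliff,
    dotProduct_cliff_comm (flip (quad s)), cliff_flip_quad, dotProduct_zero, sub_zero,
    smul_dotProduct, smul_eq_mul, mul_comm, dotProduct_comm v]

theorem quadPolar_cliff_cliff_of_pure {s : Fin 16 → ℂ} (hs : quad s = 0) (v w : Fin 10 → ℂ) :
    quadPolar s (cliff v (cliff w s)) = 0 := by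
  have h₀ : ∀ u, s ⬝ᵥ cliff u s = 0 := fun u => by
    rw [dotProduct_cliff_self, hs, dotProduct_zero, mul_zero]
  have hXY : ∀ u, s ⬝ᵥ cliff u (cliff v (cliff w s)) = - (s ⬝ᵥ cliff w (cliff v (cliff u s))) := by
    intro u
    have h₁ : cliff (flip u) (cliff w s) =
        (flip u ⬝ᵥ w) • s - cliff (flip w) (cliff u s) := by
      rw [← cliff_cliff, flip_flip, add_sub_cancel_right]
    have h₂ : ∀ a b : Fin 16 → ℂ, ∀ z, cliff z (a - b) = cliff z a - cliff z b := fun a b z => by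
      rw [sub_eq_add_neg, ← neg_one_smul ℂ b, cliff_add, cliff_smul, neg_one_smul, ← sub_eq_add_neg]
    rw [dotProduct_cliff_cliff u v, h₀, h₁, h₂, cliff_smul, dotProduct_sub, dotProduct_smul, h₀,
      dotProduct_cliff_cliff (flip v) (flip w), h₀, flip_flip, flip_flip]
    simp
  refine dotProduct_eq _ _ fun u => ?_
  rw [zero_dotProduct, dotProduct_comm, ← dotProduct_cliff]
  have h₃ := hXY u
  have h₄ : s ⬝ᵥ cliff w (cliff v (cliff u s)) = s ⬝ᵥ cliff u (cliff v (cliff w s)) := by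
    rw [dotProduct_cliff_comm w, dotProduct_comm, dotProduct_cliff_comm u, dotProduct_cliff_comm v,
      dotProduct_comm]
  rw [h₄] at h₃
  linear_combination h₃ / 2

/-- A symmetric matrix of rank at least `5` is not identically isotropic on any subspace of
codimension `2`. -/
theorem exists_dotProduct_map_self_ne_zero {n : ℕ} (T : (Fin n → ℂ) →ₗ[ℂ] (Fin n → ℂ))
    (hT : ∀ x y, x ⬝ᵥ T y = y ⬝ᵥ T x) (hr : 4 < Module.finrank ℂ (LinearMap.range T))
    (c d : Fin n → ℂ) : ∃ s, s ⬝ᵥ c = 0 ∧ s ⬝ᵥ d = 0 ∧ s ⬝ᵥ T s ≠ 0 := by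
  by_contra! hcon
  let L : Fin 2 → Module.Dual ℂ (Fin n → ℂ) := ![dotProductBilin ℂ ℂ c, dotProductBilin ℂ ℂ d]
  let K : Submodule ℂ (Fin n → ℂ) := ⨅ i, LinearMap.ker (L i)
  have hK : ∀ x, x ∈ K ↔ x ⬝ᵥ c = 0 ∧ x ⬝ᵥ d = 0 := by
    intro x
    simp [K, L, Fin.forall_fin_two, dotProduct_comm x]
  have hpol : ∀ x ∈ K, ∀ y ∈ K, x ⬝ᵥ T y = 0 := by
    intro x hx y hy
    have h₁ := hcon x ((hK x).1 hx).1 ((hK x).1 hx).2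
    have h₂ := hcon y ((hK y).1 hy).1 ((hK y).1 hy).2
    have hxy := K.add_mem hx hy
    have h₃ := hcon (x + y) ((hK _).1 hxy).1 ((hK _).1 hxy).2
    rw [map_add, add_dotProduct, dotProduct_add, dotProduct_add, h₁, h₂, hT y x] at h₃
    linear_combination h₃ / 2
  have hspan : ∀ y ∈ K, T y ∈ Submodule.span ℂ (Set.range ![c, d]) := by
    intro y hy
    have h₁ : dotProductBilin ℂ ℂ (T y) ∈ Submodule.span ℂ (Set.range L) := by
      refine mem_span_of_iInf_ker_le_ker fun x hx => ?_
      rw [LinearMap.mem_ker]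
      have := hpol x hx y hy
      rw [dotProduct_comm] at this
      simpa using this
    rw [Submodule.mem_span_range_iff_exists_fun] at h₁ ⊢
    obtain ⟨a, ha⟩ := h₁
    refine ⟨a, dotProduct_eq _ _ fun v => ?_⟩
    have := congrArg (fun l : Module.Dual ℂ (Fin n → ℂ) => l v) ha
    simpa [Fin.sum_univ_two, L, add_dotProduct] using this
  have hn := LinearMap.finrank_range_add_finrank_ker T
  have hk := LinearMap.finrank_range_add_finrank_ker (T.domRestrict K)
  have hl := LinearMap.finrank_range_add_finrank_ker (LinearMap.pi L)
  rw [LinearMap.ker_pi] at hl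
  have hl₂ : Module.finrank ℂ (LinearMap.range (LinearMap.pi L)) ≤ 2 :=
    (Submodule.finrank_le _).trans (by simp)
  have hrange : Module.finrank ℂ (LinearMap.range (T.domRestrict K)) ≤ 2 := by
    refine (Submodule.finrank_mono (t := Submodule.span ℂ (Set.range ![c, d])) ?_).trans ?_
    · rintro _ ⟨y, rfl⟩
      exact hspan y y.2
    · exact (finrank_range_le_card (R := ℂ) ![c, d]).trans (by simp)
  have hker : Module.finrank ℂ (LinearMap.ker (T.domRestrict K)) ≤
      Module.finrank ℂ (LinearMap.ker T) := by
    rw [← Submodule.finrank_map_subtype_eq K]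
    refine Submodule.finrank_mono ?_
    rintro _ ⟨y, hy, rfl⟩
    simpa using hy
  change _ + Module.finrank ℂ K = _ at hl
  simp only [Module.finrank_fintype_fun_eq_card, Fintype.card_fin] at hl hn
  omega

/-- `flip` as a linear map. -/
def flipLin : (Fin 10 → ℂ) →ₗ[ℂ] (Fin 10 → ℂ) where
  toFun := flip
  map_add' := flip_add
  map_smul' := flip_smul

/-- Clifford multiplication by a fixed vector, as a linear map. -/
def cliffLin (w : Fin 10 → ℂ) : (Fin 16 → ℂ) →ₗ[ℂ] (Fin 16 → ℂ) where
  toFun := cliff w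
  map_add' := cliff_add w
  map_smul' c s := cliff_smul c w s

theorem exists_dotProduct_flip_self_ne_zero (c d : Fin 10 → ℂ) :
    ∃ z, z ⬝ᵥ c = 0 ∧ z ⬝ᵥ d = 0 ∧ z ⬝ᵥ flip z ≠ 0 := by
  refine exists_dotProduct_map_self_ne_zero flipLin dotProduct_flip_comm ?_ c d
  have h : LinearMap.range flipLin = ⊤ :=
    LinearMap.range_eq_top.2 fun z => ⟨flip z, flip_flip z⟩
  rw [h, finrank_top]
  simp

theorem single_one_dotProduct_flip (j : Fin 10) :
    (flip (Pi.single j 1) : Fin 10 → ℂ) ⬝ᵥ Pi.single j 1 = 0 := by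
  fin_cases j <;> simp [flip]

theorem cliff_single_cliff (b : Fin 10 → ℂ) (j : Fin 10) (s : Fin 16 → ℂ) :
    cliff (Pi.single j 1) (cliff b (cliff (Pi.single j 1) s)) =
      b j • cliff (Pi.single j 1) s := by
  have h₁ := cliff_cliff b (Pi.single j 1) s
  rw [dotProduct_single_one] at h₁
  have h₂ : ∀ x, cliff (Pi.single j (1 : ℂ)) (cliff (flip (Pi.single j 1)) x) = 0 := by
    intro x
    have := cliff_flip_cliff (flip (Pi.single j 1)) x
    rw [flip_flip, single_one_dotProduct_flip] at this
    simpa using this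
  have h₃ := congrArg (cliff (Pi.single j 1)) h₁
  rwa [cliff_add, h₂, add_zero, cliff_smul] at h₃

theorem four_lt_finrank_range_cliffLin {b : Fin 10 → ℂ} (hb : b ≠ 0) :
    4 < Module.finrank ℂ (LinearMap.range (cliffLin b)) := by
  obtain ⟨j, hj⟩ := Function.ne_iff.1 hb
  have hli : LinearIndependent ℂ
      fun i : Fin 5 => (Pi.single (rangeWeights j i) 1 : Fin 16 → ℂ) := by
    simpa [Function.comp_def] using
      (Pi.basisFun ℂ (Fin 16)).linearIndependent.comp _ (rangeWeights_injective j)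
  have hcard := finrank_span_eq_card hli
  have hle : Submodule.span ℂ (Set.range
      fun i : Fin 5 => (Pi.single (rangeWeights j i) 1 : Fin 16 → ℂ)) ≤
      (LinearMap.range (cliffLin b)).map (cliffLin (Pi.single j 1)) := by
    rw [Submodule.span_le]
    rintro _ ⟨i, rfl⟩
    refine ⟨cliff b (cliff (Pi.single j 1)
      ((b j)⁻¹ • cliff (Pi.single j 1) (Pi.single (rangeWeights j i) 1))), ⟨_, rfl⟩, ?_⟩
    change cliff _ (cliff b _) = _
    rw [cliff_single_cliff, cliff_smul, smul_smul, cliff_single_cliff_single,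
      mul_inv_cancel₀ (by simpa using hj), one_smul]
  have h₁ := Submodule.finrank_mono hle
  have h₂ := Submodule.finrank_map_le (cliffLin (Pi.single j 1)) (LinearMap.range (cliffLin b))
  rw [hcard, Fintype.card_fin] at h₁
  omega

theorem exists_dotProduct_quad_ne_zero {b : Fin 10 → ℂ} (hb : b ≠ 0) (c d : Fin 16 → ℂ) :
    ∃ s, s ⬝ᵥ c = 0 ∧ s ⬝ᵥ d = 0 ∧ b ⬝ᵥ quad s ≠ 0 := by
  obtain ⟨s, h₁, h₂, h₃⟩ := exists_dotProduct_map_self_ne_zero (cliffLin b)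
    (dotProduct_cliff_comm b) (four_lt_finrank_range_cliffLin hb) c d
  refine ⟨s, h₁, h₂, fun h => h₃ ?_⟩
  change s ⬝ᵥ cliff b s = 0
  rw [dotProduct_cliff_self, h, mul_zero]

theorem exists_dotProduct_eq {n : ℕ} (l : Module.Dual ℂ (Fin n → ℂ)) : ∃ u, ∀ z, l z = u ⬝ᵥ z := by
  refine ⟨fun i => l (Pi.single i 1), fun z => ?_⟩
  rw [LinearMap.pi_apply_eq_sum_univ l z, dotProduct]
  refine Finset.sum_congr rfl fun i _ => ?_
  rw [smul_eq_mul, mul_comm]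
  congr 2
  funext k
  simp [Pi.single_apply, eq_comm]

/-- The squared length of a linear combination for the invariant form on `ℂ¹⁰`. -/
theorem add_smul_dotProduct_flip (y z : Fin 10 → ℂ) (x : ℂ) :
    (y + x • z) ⬝ᵥ flip (y + x • z) =
      y ⬝ᵥ flip y + 2 * x * (y ⬝ᵥ flip z) + x ^ 2 * (z ⬝ᵥ flip z) := by
  rw [flip_add, flip_smul, add_dotProduct, dotProduct_add, dotProduct_add, smul_dotProduct,
    smul_dotProduct, dotProduct_smul, dotProduct_smul, dotProduct_flip_comm z y]
  simp only [smul_eq_mul]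
  ring

theorem bilin_add_smul {n : ℕ} (B : LinearMap.BilinForm ℂ (Fin n → ℂ)) (y z : Fin n → ℂ) (x : ℂ) :
    B (y + x • z) (y + x • z) = B y y + x * (B y z + B z y) + x ^ 2 * B z z := by
  simp only [map_add, map_smul, LinearMap.add_apply, LinearMap.smul_apply, smul_eq_mul]
  ring

/-- A quadratic form vanishing on the null vectors of `b^⊥` is, on null vectors, divisible
by the linear form `b`. -/
theorem exists_eq_mul_of_null {b : Fin 10 → ℂ} (hb : b ≠ 0)
    (B : LinearMap.BilinForm ℂ (Fin 10 → ℂ))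
    (hB : ∀ z, z ⬝ᵥ b = 0 → z ⬝ᵥ flip z = 0 → B z z = 0) :
    ∃ u, ∀ z, z ⬝ᵥ flip z = 0 → B z z = (z ⬝ᵥ b) * (u ⬝ᵥ z) := by
  obtain ⟨z₀, hz₀, -, hN₀⟩ := exists_dotProduct_flip_self_ne_zero b b
  obtain ⟨z₁, hz₁, hz₁₀, hN₁⟩ := exists_dotProduct_flip_self_ne_zero b (flip z₀)
  obtain ⟨κ, hκ⟩ : ∃ κ, B z₀ z₀ = κ * (z₀ ⬝ᵥ flip z₀) := 
    ⟨B z₀ z₀ / (z₀ ⬝ᵥ flip z₀), (div_mul_cancel₀ _ hN₀).symm⟩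
  have hsq : ∀ z, z ⬝ᵥ b = 0 → z ⬝ᵥ flip z₀ = 0 →
      B z z = κ * (z ⬝ᵥ flip z) ∧ (z ⬝ᵥ flip z ≠ 0 → B z z₀ + B z₀ z = 0) := by
    intro z hz hzz
    obtain ⟨x, hx⟩ := IsAlgClosed.exists_pow_nat_eq (-(z ⬝ᵥ flip z) / (z₀ ⬝ᵥ flip z₀)) two_pos
    have hx' : x ^ 2 * (z₀ ⬝ᵥ flip z₀) = -(z ⬝ᵥ flip z) := by rw [hx]; field_simp
    have key : ∀ y : ℂ, y ^ 2 = x ^ 2 → B z z + y * (B z z₀ + B z₀ z) + y ^ 2 * B z₀ z₀ = 0 := by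
      intro y hy
      rw [← bilin_add_smul]
      refine hB _ ?_ ?_
      · rw [add_dotProduct, smul_dotProduct, hz, hz₀]; simp
      · rw [add_smul_dotProduct_flip, hzz, hy]; linear_combination hx'
    have k₁ := key x rfl
    have k₂ := key (-x) (neg_sq x)
    rw [hκ] at k₁ k₂
    refine ⟨by linear_combination (k₁ + k₂) / 2 - κ * hx', fun hne => ?_⟩
    have hx0 : x ≠ 0 := by
      rintro rfl
      exact hne (by linear_combination hx')
    refine (mul_eq_zero.1 (?_ : x * (B z z₀ + B z₀ z) = 0)).resolve_left hx0
    linear_combination (k₁ - k₂) / 2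
  have hcross : ∀ z, z ⬝ᵥ b = 0 → z ⬝ᵥ flip z₀ = 0 → B z z₀ + B z₀ z = 0 := by
    intro z hz hzz
    have h₁ := (hsq z₁ hz₁ hz₁₀).2 hN₁
    have key : ∀ y : ℂ, (z + y • z₁) ⬝ᵥ flip (z + y • z₁) ≠ 0 → B z z₀ + B z₀ z = 0 := by
      intro y hy
      have h₂ := (hsq (z + y • z₁) (by rw [add_dotProduct, smul_dotProduct, hz, hz₁]; simp)
        (by rw [add_dotProduct, smul_dotProduct, hzz, hz₁₀]; simp)).2 hy
      simp only [map_add, map_smul, LinearMap.add_apply, LinearMap.smul_apply, smul_eq_mul] at h₂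
      linear_combination h₂ - y * h₁
    by_cases h₃ : (z + (1 : ℂ) • z₁) ⬝ᵥ flip (z + (1 : ℂ) • z₁) = 0
    · by_cases h₄ : (z + (-1 : ℂ) • z₁) ⬝ᵥ flip (z + (-1 : ℂ) • z₁) = 0
      · by_cases h₅ : z ⬝ᵥ flip z = 0
        · rw [add_smul_dotProduct_flip, h₅] at h₃ h₄
          exact absurd (by linear_combination (h₃ + h₄) / 2) hN₁
        · exact (hsq z hz hzz).2 h₅
      · exact key _ h₄
    · exact key _ h₃
  have hperp : ∀ z, z ⬝ᵥ b = 0 → B z z = κ * (z ⬝ᵥ flip z) := by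
    intro z hz
    obtain ⟨a, ha⟩ : ∃ a, z ⬝ᵥ flip z₀ = a * (z₀ ⬝ᵥ flip z₀) :=
      ⟨z ⬝ᵥ flip z₀ / (z₀ ⬝ᵥ flip z₀), (div_mul_cancel₀ _ hN₀).symm⟩
    obtain ⟨y, rfl⟩ : ∃ y, z = y + a • z₀ := ⟨z - a • z₀, by simp⟩
    have hy : y ⬝ᵥ flip z₀ = 0 := by
      rw [add_dotProduct, smul_dotProduct, smul_eq_mul] at ha
      linear_combination ha
    have hyb : y ⬝ᵥ b = 0 := by
      rw [add_dotProduct, smul_dotProduct, hz₀, smul_zero, add_zero] at hz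
      exact hz
    rw [bilin_add_smul, add_smul_dotProduct_flip, hcross y hyb hy, (hsq y hyb hy).1, hκ, hy]
    ring
  obtain ⟨j, hj⟩ := Function.ne_iff.1 hb
  obtain ⟨c, hc⟩ : ∃ c, c ⬝ᵥ b = 1 :=
    ⟨Pi.single j (b j)⁻¹, by rw [single_dotProduct, inv_mul_cancel₀ (by simpa using hj)]⟩
  obtain ⟨u, hu⟩ := exists_dotProduct_eq (LinearMap.flip B c + B c
    - (2 * κ) • dotProductBilin ℂ ℂ (flip c)
    + (κ * (c ⬝ᵥ flip c) - B c c) • dotProductBilin ℂ ℂ b)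
  refine ⟨u, fun z hz => ?_⟩
  rw [← hu]
  obtain ⟨β, hβ⟩ : ∃ β, z ⬝ᵥ b = β := ⟨_, rfl⟩
  have h₁ := hperp (z + (-β) • c) (by
    rw [add_dotProduct, smul_dotProduct, hc, hβ]; simp)
  rw [bilin_add_smul, add_smul_dotProduct_flip, hz] at h₁
  simp only [LinearMap.add_apply, LinearMap.sub_apply, LinearMap.smul_apply, LinearMap.flip_apply,
    dotProductBilin_apply_apply, smul_eq_mul]
  rw [dotProduct_comm b, dotProduct_comm (flip c), hβ]
  linear_combination h₁

theorem exists_quadPolar_eq_zero {φ : Fin 16 → ℂ} (hφ : φ ≠ 0) :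
    ∃ t, quadPolar φ t = 0 ∧ quad t ≠ 0 := by
  by_cases hq : quad φ = 0
  · obtain ⟨k, hk⟩ := Function.ne_iff.1 hφ
    obtain ⟨v₁, v₂, v₃, v₄, v₅, hv⟩ := exists_dotProduct_cliff_eq_sq (R := ℂ) k
    refine ⟨cliff v₂ (cliff v₁ φ) + cliff v₄ (cliff v₅ φ), ?_, fun h => ?_⟩
    · rw [quadPolar_add_right, quadPolar_cliff_cliff_of_pure hq, quadPolar_cliff_cliff_of_pure hq,
        add_zero]
    · rw [quad_add, quad_cliff_of_pure (quad_cliff_of_pure hq _),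
        quad_cliff_of_pure (quad_cliff_of_pure hq _), zero_add, add_zero] at h
      have h₁ := hv φ
      rw [dotProduct_cliff_comm v₁, dotProduct_comm, dotProduct_cliff_comm v₂, dotProduct_comm,
        dotProduct_cliff, h, dotProduct_zero] at h₁
      exact hk (pow_eq_zero_iff two_ne_zero |>.1 h₁.symm)
  · obtain ⟨r, hr, -, hr'⟩ := exists_dotProduct_quad_ne_zero hq φ φ
    refine ⟨cliff (quad φ) r, ?_, ?_⟩
    · rw [quadPolar_cliff_quad, dotProduct_comm, hr, zero_smul]
    · rw [quad_cliff_of_null (quad_dotProduct_flip_quad φ)]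
      exact smul_ne_zero hr' hq

theorem eq_zero_of_mul_mul_eq_zero {a₀ a₁ a₂ b₀ b₁ b₂ c₀ c₁ c₂ : ℂ} (hb : b₂ ≠ 0) (hc : c₂ ≠ 0)
    (h : ∀ x : ℂ, (a₀ + x * a₁ + x ^ 2 * a₂) * ((b₀ + x * b₁ + x ^ 2 * b₂) *
      (c₀ + x * c₁ + x ^ 2 * c₂)) = 0) : a₀ = 0 := by
  let P : ℂ → ℂ → ℂ → Polynomial ℂ := fun d₀ d₁ d₂ =>
    Polynomial.C d₀ + Polynomial.X * Polynomial.C d₁ + Polynomial.X ^ 2 * Polynomial.C d₂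
  have hP : P a₀ a₁ a₂ * (P b₀ b₁ b₂ * P c₀ c₁ c₂) = 0 := by
    refine Polynomial.funext fun x => ?_
    simp only [P, Polynomial.eval_mul, Polynomial.eval_add, Polynomial.eval_pow, Polynomial.eval_X,
      Polynomial.eval_C, Polynomial.eval_zero]
    exact h x
  have hne : ∀ {d₀ d₁ d₂ : ℂ}, d₂ ≠ 0 → P d₀ d₁ d₂ ≠ 0 := by
    intro d₀ d₁ d₂ hd h₀
    have := congrArg (fun p => Polynomial.coeff p 2) h₀
    simp [P] at this
    exact hd this
  have h₀ := (mul_eq_zero.1 hP).resolve_right (mul_ne_zero (hne hb) (hne hc))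
  simpa [P] using congrArg (Polynomial.eval 0) h₀

/-- A quadratic form vanishing on a hyperplane section of the cone over the spinor variety is,
on the hyperplane, a combination of the equations `quad`. -/
theorem exists_eq_dotProduct_quad {φ : Fin 16 → ℂ} (hφ : φ ≠ 0)
    (B : LinearMap.BilinForm ℂ (Fin 16 → ℂ))
    (hB : ∀ s, φ ⬝ᵥ s = 0 → quad s = 0 → B s s = 0) :
    ∃ u : Fin 10 → ℂ, ∀ s, φ ⬝ᵥ s = 0 → B s s = u ⬝ᵥ quad s := by
  obtain ⟨t, ht, hb⟩ := exists_quadPolar_eq_zero hφ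
  obtain ⟨b, hbt⟩ : ∃ b, quad t = b := ⟨_, rfl⟩
  rw [hbt] at hb
  have hperp : ∀ z, φ ⬝ᵥ cliff z t = 0 := fun z => by
    rw [dotProduct_cliff, ht, dotProduct_zero]
  have hquad : ∀ z : Fin 10 → ℂ, z ⬝ᵥ flip z = 0 → quad (cliff z t) = (z ⬝ᵥ b) • z := by
    intro z hz
    rw [quad_cliff_of_null hz, hbt]
  let T : (Fin 10 → ℂ) →ₗ[ℂ] (Fin 16 → ℂ) :=
    { toFun := fun z => cliff z t
      map_add' := fun v w => cliff_add_left v w t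
      map_smul' := fun c w => cliff_smul_left c w t }
  obtain ⟨u, hu⟩ := exists_eq_mul_of_null hb (LinearMap.compl₁₂ B T T) (by
    intro z hz hN
    exact hB _ (hperp z) (by rw [show quad (T z) = _ from hquad z hN, hz, zero_smul]))
  have hu' : ∀ z, z ⬝ᵥ flip z = 0 → B (cliff z t) (cliff z t) = (z ⬝ᵥ b) * (u ⬝ᵥ z) := hu
  have hprod : ∀ s, φ ⬝ᵥ s = 0 → (B s s - u ⬝ᵥ quad s) *
      ((b ⬝ᵥ quad s) * ((s ⬝ᵥ t) ^ 2 - 4 * (b ⬝ᵥ quad s))) = 0 := by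
    intro s hs
    by_cases hD : (s ⬝ᵥ t) ^ 2 - 4 * (b ⬝ᵥ quad s) = 0
    · rw [hD]; ring
    obtain ⟨d, hd⟩ := IsAlgClosed.exists_pow_nat_eq ((s ⬝ᵥ t) ^ 2 - 4 * (b ⬝ᵥ quad s)) two_pos
    have hd0 : d ≠ 0 := by
      rintro rfl
      exact hD (by rw [← hd]; ring)
    have hN := quad_dotProduct_flip_quad s
    have hroot : ∀ x : ℂ, x ^ 2 + x * (s ⬝ᵥ t) + b ⬝ᵥ quad s = 0 →
        B (cliff (quad s) t) (cliff (quad s) t) +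
          x * (B (cliff (quad s) t) s + B s (cliff (quad s) t)) + x ^ 2 * B s s = 0 := by
      intro x hx
      rw [← bilin_add_smul]
      refine hB _ ?_ ?_
      · rw [dotProduct_add, hperp, dotProduct_smul, hs]; simp
      · rw [quad_add, quad_smul, quadPolar_smul_right, quadPolar_comm, quadPolar_cliff_quad,
          hquad _ hN, smul_smul, ← add_smul, ← add_smul, dotProduct_comm _ b]
        rw [show b ⬝ᵥ quad s + x * s ⬝ᵥ t + x ^ 2 = 0 by linear_combination hx, zero_smul]
    have h₁ := hroot ((-(s ⬝ᵥ t) + d) / 2) (by linear_combination hd / 4)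
    have h₂ := hroot ((-(s ⬝ᵥ t) - d) / 2) (by linear_combination hd / 4)
    rw [hu' _ hN, dotProduct_comm _ b] at h₁ h₂
    have h₃ : d * ((B s s - u ⬝ᵥ quad s) * (b ⬝ᵥ quad s)) = 0 := by
      linear_combination ((-(s ⬝ᵥ t) - d) / 2) * h₁ - ((-(s ⬝ᵥ t) + d) / 2) * h₂
        + (B s s) * d / 4 * hd
    rw [← mul_assoc, (mul_eq_zero.1 h₃).resolve_left hd0, zero_mul]
  obtain ⟨s₁, hs₁, hst₁, hb₁⟩ := exists_dotProduct_quad_ne_zero hb φ t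
  rw [dotProduct_comm] at hs₁
  refine ⟨u, fun s hs => sub_eq_zero.1 ?_⟩
  refine eq_zero_of_mul_mul_eq_zero (a₁ := B s s₁ + B s₁ s - u ⬝ᵥ quadPolar s s₁)
    (a₂ := B s₁ s₁ - u ⬝ᵥ quad s₁) (b₀ := b ⬝ᵥ quad s) (b₁ := b ⬝ᵥ quadPolar s s₁) hb₁
    (c₀ := (s ⬝ᵥ t) ^ 2 - 4 * (b ⬝ᵥ quad s)) (c₁ := -4 * (b ⬝ᵥ quadPolar s s₁))
    (mul_ne_zero (by norm_num : (-4 : ℂ) ≠ 0) hb₁) fun x => ?_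
  have h := hprod (s + x • s₁) (by rw [dotProduct_add, dotProduct_smul, hs, hs₁]; simp)
  rw [bilin_add_smul, quad_add, quad_smul, quadPolar_smul_right, add_dotProduct, smul_dotProduct,
    hst₁] at h
  simp only [dotProduct_add, dotProduct_smul, smul_eq_mul] at h
  linear_combination h

theorem exists_null_vector (u : Fin 8 → Fin 10 → ℂ) :
    ∃ w, w ≠ 0 ∧ w ⬝ᵥ flip w = 0 ∧ ∀ i, u i ⬝ᵥ w = 0 := by
  let L : (Fin 10 → ℂ) →ₗ[ℂ] (Fin 8 → ℂ) := LinearMap.pi fun i => dotProductBilin ℂ ℂ (u i)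
  have hL : ∀ w, w ∈ LinearMap.ker L ↔ ∀ i, u i ⬝ᵥ w = 0 := by
    intro w
    simp [L, funext_iff]
  have hdim : 1 < Module.finrank ℂ (LinearMap.ker L) := by
    have h₁ := LinearMap.finrank_range_add_finrank_ker L
    have h₂ := Submodule.finrank_le (LinearMap.range L)
    simp only [Module.finrank_fintype_fun_eq_card, Fintype.card_fin] at h₁ h₂
    omega
  obtain ⟨⟨y, hy⟩, hy0⟩ := Module.finrank_pos_iff_exists_ne_zero.1 (zero_lt_one.trans hdim)
  have hy0' : y ≠ 0 := fun h => hy0 (Subtype.ext h)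
  by_cases hN : y ⬝ᵥ flip y = 0
  · exact ⟨y, hy0', hN, (hL y).1 hy⟩
  obtain ⟨⟨x, hx⟩, hxy⟩ : ∃ x : LinearMap.ker L, ∀ c : ℂ, c • (⟨y, hy⟩ : LinearMap.ker L) ≠ x := by
    by_contra! h
    exact absurd (finrank_le_one _ h) (not_le.2 hdim)
  obtain ⟨d, hd⟩ := IsAlgClosed.exists_pow_nat_eq
    ((x ⬝ᵥ flip y) ^ 2 - (x ⬝ᵥ flip x) * (y ⬝ᵥ flip y)) two_pos
  obtain ⟨a, ha⟩ : ∃ a, a * (y ⬝ᵥ flip y) = d - x ⬝ᵥ flip y :=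
    ⟨_, div_mul_cancel₀ _ hN⟩
  refine ⟨x + a • y, fun h => hxy (-a) (Subtype.ext ?_), ?_, (hL _).1 ?_⟩
  · change -a • y = x
    rw [neg_smul, eq_comm]
    exact eq_neg_of_add_eq_zero_left h
  · rw [add_smul_dotProduct_flip]
    refine (mul_eq_zero.1 (?_ : (y ⬝ᵥ flip y) * _ = 0)).resolve_left hN
    linear_combination (a * (y ⬝ᵥ flip y) + x ⬝ᵥ flip y + d) * ha + hd
  · exact Submodule.add_mem _ hx (Submodule.smul_mem _ _ hy)

/-- Eight quadratic forms do not cut out a hyperplane section of the spinor variety. -/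
theorem exists_bilin_eq_zero_quad_ne_zero {φ : Fin 16 → ℂ} (hφ : φ ≠ 0)
    (B : Fin 8 → LinearMap.BilinForm ℂ (Fin 16 → ℂ))
    (hB : ∀ i s, φ ⬝ᵥ s = 0 → quad s = 0 → B i s s = 0) :
    ∃ s, φ ⬝ᵥ s = 0 ∧ quad s ≠ 0 ∧ ∀ i, B i s s = 0 := by
  choose u hu using fun i => exists_eq_dotProduct_quad hφ (B i) (hB i)
  obtain ⟨w, hw, hN, huw⟩ := exists_null_vector u
  obtain ⟨r, hr, -, hr'⟩ := exists_dotProduct_quad_ne_zero hw (cliff w φ) 0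
  have hs : φ ⬝ᵥ cliff w r = 0 := by rw [dotProduct_cliff_comm, hr]
  have hq := quad_cliff_of_null hN r
  refine ⟨cliff w r, hs, hq ▸ smul_ne_zero hr' hw, fun i => ?_⟩
  rw [hu i _ hs, hq, dotProduct_smul, huw, smul_zero]

theorem quad_map {S : Type*} [CommRing S] (f : R →+* S) (s : Fin 16 → R) :
    quad (f ∘ s) = f ∘ quad s := by
  funext i; fin_cases i <;> simp [quad]

theorem spinorVec_eq (A : Fin 5 → Fin 5 → ℂ) : spinorVec A =
    ![1, A 0 1, A 0 2, A 0 3, A 0 4, A 1 2, A 1 3, A 1 4, A 2 3, A 2 4, A 3 4,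
      subPfaffian A 0, subPfaffian A 1, subPfaffian A 2, subPfaffian A 3, subPfaffian A 4] := by
  funext i; fin_cases i <;> rfl

theorem quad_spinorVec (A : Fin 5 → Fin 5 → ℂ) : quad (spinorVec A) = 0 := by
  rw [spinorVec_eq]
  funext i
  fin_cases i <;> simp [quad, subPfaffian, pfc] <;> ring

theorem quad_eq_zero_of_mem_Spinor10 {x : PS 16} (hx : x ∈ Spinor10) {v : Fin 16 → ℂ}
    (hv : v ∈ x.submodule) : quad v = 0 := by
  have heval : ∀ (v : Fin 16 → ℂ) (j : Fin 10),
      MvPolynomial.eval v (quad (MvPolynomial.X : Fin 16 → MvPolynomial (Fin 16) ℂ) j) =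
        quad v j := by
    intro v j
    have h := congrFun (quad_map (MvPolynomial.eval v) MvPolynomial.X) j
    rw [show MvPolynomial.eval v ∘ MvPolynomial.X = v by funext i; simp] at h
    exact h.symm
  have h := hx (ZeroLocus (Set.range (quad (MvPolynomial.X : Fin 16 → MvPolynomial (Fin 16) ℂ))))
    ⟨⟨_, rfl⟩, by
      rintro _ ⟨A, -, hA, rfl⟩ _ ⟨j, rfl⟩ w hw
      rw [Projectivization.submodule_mk, Submodule.mem_span_singleton] at hw
      obtain ⟨c, rfl⟩ := hw
      rw [heval, quad_smul, quad_spinorVec, smul_zero, Pi.zero_apply]⟩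
  funext j
  rw [← heval]
  exact h _ ⟨j, rfl⟩ v hv

theorem exists_eq_smul_spinorVec {s : Fin 16 → ℂ} (h₀ : s 0 ≠ 0) (hs : quad s = 0) :
    ∃ A : Fin 5 → Fin 5 → ℂ, (∀ i j, A j i = - A i j) ∧ s = s 0 • spinorVec A := by
  have hq : ∀ i, quad s i = 0 := fun i => congrFun hs i
  have h₁₁ := hq 0
  have h₁₂ := hq 1
  have h₁₃ := hq 2
  have h₁₄ := hq 3
  have h₁₅ := hq 4
  simp only [quad] at h₁₁ h₁₂ h₁₃ h₁₄ h₁₅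
  refine ⟨fun i j => (s 0)⁻¹ * (![![0, s 1, s 2, s 3, s 4], ![-s 1, 0, s 5, s 6, s 7],
    ![-s 2, -s 5, 0, s 8, s 9], ![-s 3, -s 6, -s 8, 0, s 10],
    ![-s 4, -s 7, -s 9, -s 10, 0]] : Fin 5 → Fin 5 → ℂ) i j, ?_, ?_⟩
  · intro i j
    fin_cases i <;> fin_cases j <;> simp
  · rw [spinorVec_eq]
    funext k
    fin_cases k <;> simp [subPfaffian, pfc] <;> field_simp
    · linear_combination h₁₁
    · linear_combination h₁₂
    · linear_combination h₁₃
    · linear_combination h₁₄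
    · linear_combination h₁₅

theorem eval_eq_zero_of_eval_add_smul {n : ℕ} (p : MvPolynomial (Fin n) ℂ) (s r : Fin n → ℂ)
    (h : ∀ x : ℂ, x ≠ 0 → MvPolynomial.eval (s + x • r) p = 0) : MvPolynomial.eval s p = 0 := by
  let P : Polynomial ℂ := MvPolynomial.aeval
    (fun i => Polynomial.C (s i) + Polynomial.X * Polynomial.C (r i)) p
  have hP : ∀ x, P.eval x = MvPolynomial.eval (s + x • r) p := by
    intro x
    simp only [P]
    rw [← Polynomial.coe_evalRingHom, MvPolynomial.aeval_def, MvPolynomial.hom_eval₂]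
    rw [MvPolynomial.eval, MvPolynomial.coe_eval₂Hom]
    congr 1
    · ext; simp
    · funext i; simp; ring
  have h₀ : Polynomial.X * P = 0 := by
    refine Polynomial.funext fun x => ?_
    rw [Polynomial.eval_mul, Polynomial.eval_X, hP, Polynomial.eval_zero]
    by_cases hx : x = 0
    · rw [hx, zero_mul]
    · rw [h x hx, mul_zero]
  have h₁ := hP 0
  rw [(mul_eq_zero.1 h₀).resolve_left Polynomial.X_ne_zero] at h₁
  simpa using h₁.symm

theorem quad_add_smul_cliff_cliff {s : Fin 16 → ℂ} (hs : quad s = 0) (v w : Fin 10 → ℂ) (x : ℂ) :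
    quad (s + x • cliff v (cliff w s)) = 0 := by
  rw [quad_add, quad_smul, quadPolar_smul_right, quadPolar_cliff_cliff_of_pure hs, hs,
    quad_cliff_of_pure (quad_cliff_of_pure hs w)]
  simp

theorem eval_eq_zero_of_quad_eq_zero {p : MvPolynomial (Fin 16) ℂ}
    (hp : ∀ A : Fin 5 → Fin 5 → ℂ, (∀ i j, A j i = - A i j) →
      ∀ c : ℂ, MvPolynomial.eval (c • spinorVec A) p = 0)
    {s : Fin 16 → ℂ} (hs : quad s = 0) : MvPolynomial.eval s p = 0 := by
  have hchart : ∀ s, quad s = 0 → s 0 ≠ 0 → MvPolynomial.eval s p = 0 := by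
    intro s hs h₀
    obtain ⟨A, hA, hsA⟩ := exists_eq_smul_spinorVec h₀ hs
    rw [hsA]
    exact hp A hA _
  have hlow : ∀ s, quad s = 0 → ∀ k, k ≠ 0 → k < 11 → s k ≠ 0 → MvPolynomial.eval s p = 0 := by
    intro s hs k hk₀ hk hsk
    by_cases h₀ : s 0 = 0
    · obtain ⟨v, w, hvw⟩ := exists_cliff_cliff_apply_zero (R := ℂ) k hk₀ hk
      refine eval_eq_zero_of_eval_add_smul p s (cliff v (cliff w s)) fun x hx =>
        hchart _ (quad_add_smul_cliff_cliff hs v w x) ?_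
      rw [Pi.add_apply, Pi.smul_apply, hvw, h₀, zero_add]
      exact smul_ne_zero hx hsk
    · exact hchart s hs h₀
  by_cases hs₀ : s = 0
  · simpa [hs₀] using hp 0 (by simp) 0
  obtain ⟨k, hsk⟩ := Function.ne_iff.1 hs₀
  by_cases hk : k < 11
  · by_cases hk₀ : k = 0
    · exact hchart s hs (hk₀ ▸ hsk)
    · exact hlow s hs k hk₀ hk hsk
  · obtain ⟨v, w, l, hl₀, hl, hvw⟩ := exists_cliff_cliff_apply_mid (R := ℂ) k hk
    by_cases hsl : s l = 0
    · refine eval_eq_zero_of_eval_add_smul p s (cliff v (cliff w s)) fun x hx =>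
        hlow _ (quad_add_smul_cliff_cliff hs v w x) l hl₀ hl ?_
      rw [Pi.add_apply, Pi.smul_apply, hvw, hsl, zero_add]
      exact smul_ne_zero hx hsk
    · exact hlow s hs l hl₀ hl hsl

theorem mk_mem_Spinor10 {s : Fin 16 → ℂ} (h₀ : s ≠ 0) (hs : quad s = 0) :
    Projectivization.mk ℂ s h₀ ∈ Spinor10 := by
  rintro _ ⟨⟨P, rfl⟩, hC⟩ p hp v hv
  rw [Projectivization.submodule_mk, Submodule.mem_span_singleton] at hv
  obtain ⟨c, rfl⟩ := hv
  refine eval_eq_zero_of_quad_eq_zero (fun A hA c => ?_) (by rw [quad_smul, hs, smul_zero])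
  have hA₀ : spinorVec A ≠ 0 := fun h => by
    have := congrFun h 0
    rw [spinorVec_eq] at this
    simp at this
  refine hC ⟨A, hA, hA₀, rfl⟩ p hp _ ?_
  rw [Projectivization.submodule_mk]
  exact Submodule.smul_mem _ _ (Submodule.mem_span_singleton_self _)

theorem exists_bilin_eq_eval {m : ℕ} {p : MvPolynomial (Fin m) ℂ} (hp : p.IsHomogeneous 2) :
    ∃ B : LinearMap.BilinForm ℂ (Fin m → ℂ), ∀ v, MvPolynomial.eval v p = B v v := by
  have hmon : ∀ d ∈ p.support, ∃ B : LinearMap.BilinForm ℂ (Fin m → ℂ),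
      ∀ v, (d.prod fun i e => v i ^ e) = B v v := by
    intro d hd
    have hdeg : d.toMultiset.card = 2 := by
      rw [Finsupp.card_toMultiset, ← hp (MvPolynomial.mem_support_iff.1 hd)]
      simp [Finsupp.weight_apply, Finsupp.sum]
    obtain ⟨i, j, hij⟩ := Multiset.card_eq_two.1 hdeg
    refine ⟨LinearMap.mk₂ ℂ (fun v w => v i * w j) (by simp [add_mul]) (by simp [mul_assoc])
      (by simp [mul_add]) (by simp [mul_left_comm]), fun v => ?_⟩
    have hd' : d = Finsupp.single i 1 + Finsupp.single j 1 := by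
      classical
      refine Multiset.toFinsupp.symm.injective ?_
      change Finsupp.toMultiset d = Finsupp.toMultiset _
      rw [map_add, Finsupp.toMultiset_single, Finsupp.toMultiset_single, hij, one_smul, one_smul]
      rfl
    rw [hd', Finsupp.prod_add_index' (fun _ => pow_zero _) (fun _ _ _ => pow_add _ _ _),
      Finsupp.prod_single_index (h := fun i e => v i ^ e) (pow_zero _),
      Finsupp.prod_single_index (h := fun i e => v i ^ e) (pow_zero _), pow_one, pow_one,
      LinearMap.mk₂_apply]
  choose! B hB using hmon
  refine ⟨∑ d ∈ p.support, p.coeff d • B d, fun v => ?_⟩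
  rw [MvPolynomial.eval_eq]
  simp only [LinearMap.sum_apply, LinearMap.smul_apply, smul_eq_mul]
  refine Finset.sum_congr rfl fun d hd => ?_
  rw [← hB d hd, Finsupp.prod]

theorem exists_range_eq_ker {f : (Fin 15 → ℂ) →ₗ[ℂ] (Fin 16 → ℂ)}
    (hf : Module.finrank ℂ (LinearMap.range f) + 1 = 16) :
    ∃ φ : Fin 16 → ℂ, φ ≠ 0 ∧ ∀ s, s ∈ LinearMap.range f ↔ φ ⬝ᵥ s = 0 := by
  have hlt : LinearMap.range f < ⊤ := by
    refine lt_top_iff_ne_top.2 fun h => ?_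
    rw [h, finrank_top] at hf
    simp at hf
  obtain ⟨l, hl, hle⟩ := Submodule.exists_le_ker_of_lt_top _ hlt
  obtain ⟨φ, hφ⟩ := exists_dotProduct_eq l
  have hker : LinearMap.ker l < ⊤ :=
    lt_top_iff_ne_top.2 fun h => hl (LinearMap.ker_eq_top.1 h)
  have h₁ := Submodule.finrank_lt hker.ne
  have heq := Submodule.eq_of_le_of_finrank_le hle (by
    simp only [Module.finrank_fintype_fun_eq_card, Fintype.card_fin] at h₁
    omega)
  refine ⟨φ, fun h => hl (LinearMap.ext fun s => ?_), fun s => ?_⟩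
  · rw [hφ, h, zero_dotProduct, LinearMap.zero_apply]
  · rw [heq, LinearMap.mem_ker, hφ]

end SpinorClifford

/-- **Proposition 4.12 (ii).** A smooth hyperplane section `V ⊆ ℙ¹⁴` of the
10-dimensional spinor variety `S¹⁰ ⊆ ℙ¹⁵` is not scheme-theoretically defined
by `8` quadric hypersurfaces. -/
theorem spinor_section_not_cut_out_by_eight_quadrics (V : Set (PS 15))
    (hsec : ProjEquivToHyperplaneSection V Spinor10)
    (hsm : SmoothVariety V 9) :
    ¬ ∃ Q : Fin 8 → MvPolynomial (Fin 15) ℂ,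
      (∀ i, (Q i).IsHomogeneous 2) ∧ SchemeCutOutBy V Q := by
  rintro ⟨Q, hQ, hV, -⟩
  obtain ⟨f, hf, hdim, himg⟩ := hsec
  obtain ⟨φ, hφ, hrange⟩ := SpinorClifford.exists_range_eq_ker hdim
  obtain ⟨g, hg⟩ := LinearMap.exists_leftInverse_of_injective f (LinearMap.ker_eq_bot.2 hf)
  have hgf : ∀ v, g (f v) = v := fun v => LinearMap.congr_fun hg v
  choose B hB using fun i => SpinorClifford.exists_bilin_eq_eval (hQ i)
  obtain ⟨s, hs, hqs, hBs⟩ := SpinorClifford.exists_bilin_eq_zero_quad_ne_zero hφ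
    (fun i => LinearMap.compl₁₂ (B i) g g) (by
      intro i s hs hqs
      rw [LinearMap.compl₁₂_apply, ← hB]
      by_cases hs₀ : s = 0
      · rw [hs₀, map_zero, hB, map_zero]
      have hmem : Projectivization.mk ℂ s hs₀ ∈ Projectivization.map f hf '' V := by
        rw [himg]
        refine ⟨SpinorClifford.mk_mem_Spinor10 hs₀ hqs, ?_⟩
        change Submodule.span ℂ {s} ≤ _
        rw [Submodule.span_singleton_le_iff_mem]
        exact (hrange s).2 hs
      obtain ⟨x, hx, hxs⟩ := hmem
      rw [hV] at hx
      refine hx i _ ?_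
      rw [← x.mk_rep, Projectivization.map_mk, eq_comm, Projectivization.mk_eq_mk_iff'] at hxs
      obtain ⟨c, rfl⟩ := hxs
      rw [map_smul, hgf, ← x.mk_rep, Projectivization.submodule_mk, x.mk_rep]
      exact Submodule.smul_mem _ _ (Submodule.mem_span_singleton_self _))
  have hs₀ : s ≠ 0 := fun h => hqs (h ▸ SpinorClifford.quad_zero)
  obtain ⟨v, rfl⟩ := (hrange s).2 hs
  have hv₀ : v ≠ 0 := fun h => hs₀ (by rw [h, map_zero])
  have hv : Projectivization.mk ℂ v hv₀ ∈ V := by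
    rw [hV]
    intro i w hw
    rw [Projectivization.submodule_mk, Submodule.mem_span_singleton] at hw
    obtain ⟨c, rfl⟩ := hw
    have h := hBs i
    rw [LinearMap.compl₁₂_apply, hgf] at h
    rw [hB, map_smul, map_smul, LinearMap.smul_apply, h, smul_zero, smul_zero]
  have hmem := Set.mem_image_of_mem (Projectivization.map f hf) hv
  rw [himg, Projectivization.map_mk] at hmem
  refine hqs (SpinorClifford.quad_eq_zero_of_mem_Spinor10 hmem.1 ?_)
  rw [Projectivization.submodule_mk]
  exact Submodule.mem_span_singleton_self _
end
end
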